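/- arXiv:2503.01023 — 4 statements merged into one kernel-verified Lean document; each statement's English description precedes it below -/
import Mathlib

section
/- For every integer n ≥ 2, the number A_1(n) of n-noncrossing trees in which vertex 1 has degree 1 satisfies A_1(n) = Σ_{j=2}^{n} A(j−1)·A(n+1−j), where A(m) is the number of m-noncrossing trees; moreover A_1(1) = 0. -/
/-- The noncrossing condition for a graph on the vertex set `ZMod n`
(vertex `j ∈ {1,…,n}` of the paper corresponds to `j - 1 : ZMod n`):
no two edges `{a,b}` and `{c,d}` satisfy `a < c < b < d`. -/
def Noncrossing {n : ℕ} (G : SimpleGraph (ZMod n)) : Prop :=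
  ∀ a b c d : ZMod n, G.Adj a b → G.Adj c d →
    ¬(a.val < c.val ∧ c.val < b.val ∧ b.val < d.val)

/-- An `n`-noncrossing tree: a tree on `n` vertices, drawn on the circle, with no crossing edges. -/
def IsNCTree {n : ℕ} (G : SimpleGraph (ZMod n)) : Prop :=
  G.IsTree ∧ Noncrossing G

/-- `A n` is the number of `n`-noncrossing trees. -/
noncomputable def A (n : ℕ) : ℕ :=
  Nat.card {G : SimpleGraph (ZMod n) // IsNCTree G}

/-- `A₁ n` is the number of `n`-noncrossing trees where vertex `1`
(i.e. `0 : ZMod n`) has degree `1`. -/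
noncomputable def A₁ (n : ℕ) : ℕ :=
  Nat.card {G : SimpleGraph (ZMod n) // IsNCTree G ∧ (G.neighborSet 0).ncard = 1}

namespace SimpleGraph

variable {V W : Type*}

/-- A graph is connected if it receives a surjection from a connected graph that maps each edge
to an edge or to a single vertex. -/
theorem Connected.of_surjective_of_adj {G : SimpleGraph V} {H : SimpleGraph W} (hG : G.Connected)
    (r : V → W) (hr : Function.Surjective r)
    (h : ∀ u v, G.Adj u v → r u = r v ∨ H.Adj (r u) (r v)) : H.Connected := by
  have key : ∀ {u v : V}, G.Walk u v → H.Reachable (r u) (r v) := by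
    intro u v p
    induction p with
    | nil => exact Reachable.refl _
    | cons hadj _ ih =>
      rcases h _ _ hadj with e | e
      · rwa [e]
      · exact e.reachable.trans ih
  have := hG.nonempty.map r
  refine ⟨fun x y => ?_⟩
  obtain ⟨u, rfl⟩ := hr x
  obtain ⟨v, rfl⟩ := hr y
  obtain ⟨p⟩ := hG.preconnected u v
  exact key p

/-- A connected finite graph on `m + 1` vertices with at most `m` edges is a tree. -/
theorem Connected.isTree_of_ncard_edgeSet_le [Finite V] {G : SimpleGraph V} (hG : G.Connected)
    (h : G.edgeSet.ncard + 1 ≤ Nat.card V) : G.IsTree := by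
  refine isTree_iff_connected_and_card.2 ⟨hG, le_antisymm ?_ hG.card_vert_le_card_edgeSet_add_one⟩
  simpa using h

theorem IsTree.ncard_edgeSet_add_one [Finite V] {G : SimpleGraph V} (hG : G.IsTree) :
    G.edgeSet.ncard + 1 = Nat.card V :=
  (isTree_iff_connected_and_card.1 hG).2

end SimpleGraph

namespace NCTree

variable {a b : ℕ}

/-- The noncrossing condition on the vertex set `Fin n`. -/
def NoncrossingFin {n : ℕ} (G : SimpleGraph (Fin n)) : Prop :=
  ∀ a b c d : Fin n, G.Adj a b → G.Adj c d →
    ¬(a.val < c.val ∧ c.val < b.val ∧ b.val < d.val)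

/-- The embedding onto the vertices `1, …, a + 1`. -/
def left (a b : ℕ) : Fin (a + 1) ↪ Fin (a + b + 2) :=
  ⟨fun i => ⟨i + 1, by omega⟩, fun i j h => by simpa [Fin.ext_iff] using h⟩

/-- The embedding onto the vertices `a + 1, …, a + b + 1`. -/
def right (a b : ℕ) : Fin (b + 1) ↪ Fin (a + b + 2) :=
  ⟨fun i => ⟨i + (a + 1), by omega⟩, fun i j h => by simpa [Fin.ext_iff] using h⟩

/-- The vertex `a + 1` shared by the two parts. -/
def cut (a b : ℕ) : Fin (a + b + 2) := ⟨a + 1, by omega⟩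

@[simp] lemma left_val (i : Fin (a + 1)) : (left a b i : ℕ) = i + 1 := rfl

@[simp] lemma right_val (i : Fin (b + 1)) : (right a b i : ℕ) = i + (a + 1) := rfl

@[simp] lemma cut_val : (cut a b : ℕ) = a + 1 := rfl

lemma zero_ne_cut : (0 : Fin (a + b + 2)) ≠ cut a b := by
  simp [Fin.ext_iff]

lemma exists_left {u : Fin (a + b + 2)} (h₁ : 1 ≤ u.val) (h₂ : u.val ≤ a + 1) :
    ∃ i, left a b i = u :=
  ⟨⟨u - 1, by omega⟩, Fin.ext (by simp; omega)⟩

lemma exists_right {u : Fin (a + b + 2)} (h : a + 1 ≤ u.val) : ∃ i, right a b i = u :=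
  ⟨⟨u - (a + 1), by omega⟩, Fin.ext (by simp; omega)⟩

/-- Two graphs glued at `cut a b`, with the vertex `0` attached to that vertex. -/
def glue (G₁ : SimpleGraph (Fin (a + 1))) (G₂ : SimpleGraph (Fin (b + 1))) :
    SimpleGraph (Fin (a + b + 2)) :=
  G₁.map (left a b) ⊔ G₂.map (right a b) ⊔ SimpleGraph.edge 0 (cut a b)

lemma glue_adj {G₁ : SimpleGraph (Fin (a + 1))} {G₂ : SimpleGraph (Fin (b + 1))}
    {u v : Fin (a + b + 2)} :
    (glue G₁ G₂).Adj u v ↔ (∃ i j, G₁.Adj i j ∧ left a b i = u ∧ left a b j = v) ∨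
      (∃ i j, G₂.Adj i j ∧ right a b i = u ∧ right a b j = v) ∨
      (u = 0 ∧ v = cut a b ∨ u = cut a b ∧ v = 0) := by
  have := zero_ne_cut (a := a) (b := b)
  simp only [glue, SimpleGraph.sup_adj, SimpleGraph.map_adj, SimpleGraph.edge_adj]
  grind

lemma glue_adj_zero {G₁ : SimpleGraph (Fin (a + 1))} {G₂ : SimpleGraph (Fin (b + 1))}
    (v : Fin (a + b + 2)) : (glue G₁ G₂).Adj 0 v ↔ v = cut a b := by
  simp only [glue_adj, Fin.ext_iff, left_val, right_val, cut_val, Fin.val_zero]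
  grind

lemma comap_left_glue (G₁ : SimpleGraph (Fin (a + 1))) (G₂ : SimpleGraph (Fin (b + 1))) :
    (glue G₁ G₂).comap (left a b) = G₁ := by
  ext u v
  rw [SimpleGraph.comap_adj, glue_adj]
  constructor
  · rintro (⟨i, j, h, hi, hj⟩ | ⟨i, j, h, hi, hj⟩ | h)
    · rwa [← (left a b).injective hi, ← (left a b).injective hj]
    · have := h.ne
      simp only [Fin.ext_iff, left_val, right_val, ne_eq] at *
      omega
    · simp only [Fin.ext_iff, left_val, cut_val, Fin.val_zero] at h
      omega
  · exact fun h => Or.inl ⟨u, v, h, rfl, rfl⟩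

lemma comap_right_glue (G₁ : SimpleGraph (Fin (a + 1))) (G₂ : SimpleGraph (Fin (b + 1))) :
    (glue G₁ G₂).comap (right a b) = G₂ := by
  ext u v
  rw [SimpleGraph.comap_adj, glue_adj]
  constructor
  · rintro (⟨i, j, h, hi, hj⟩ | ⟨i, j, h, hi, hj⟩ | h)
    · have := h.ne
      simp only [Fin.ext_iff, left_val, right_val, ne_eq] at *
      omega
    · rwa [← (right a b).injective hi, ← (right a b).injective hj]
    · simp only [Fin.ext_iff, right_val, cut_val, Fin.val_zero] at h
      omega
  · exact fun h => Or.inr (Or.inl ⟨u, v, h, rfl, rfl⟩)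

lemma noncrossing_glue {G₁ : SimpleGraph (Fin (a + 1))} {G₂ : SimpleGraph (Fin (b + 1))}
    (h₁ : NoncrossingFin G₁) (h₂ : NoncrossingFin G₂) : NoncrossingFin (glue G₁ G₂) := by
  intro u v x y huv hxy
  rw [glue_adj] at huv hxy
  rcases huv with ⟨i, j, h, rfl, rfl⟩ | ⟨i, j, h, rfl, rfl⟩ | ⟨rfl, rfl⟩ | ⟨rfl, rfl⟩ <;>
    rcases hxy with ⟨k, l, h', rfl, rfl⟩ | ⟨k, l, h', rfl, rfl⟩ | ⟨rfl, rfl⟩ | ⟨rfl, rfl⟩ <;>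
    first
    | (have := h₁ i j k l h h'; simp only [left_val]; omega)
    | (have := h₂ i j k l h h'; simp only [right_val]; omega)
    | (simp only [left_val, right_val, cut_val, Fin.val_zero]; omega)

lemma connected_glue {G₁ : SimpleGraph (Fin (a + 1))} {G₂ : SimpleGraph (Fin (b + 1))}
    (h₁ : G₁.Connected) (h₂ : G₂.Connected) : (glue G₁ G₂).Connected := by
  have hl : ∀ i, (glue G₁ G₂).Reachable (left a b i) (cut a b) := fun i =>
    (h₁.preconnected i (Fin.last a)).map
      ⟨left a b, fun h => glue_adj.2 (Or.inl ⟨_, _, h, rfl, rfl⟩)⟩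
  have hr : ∀ i, (glue G₁ G₂).Reachable (right a b i) (cut a b) := fun i => by
    have e : right a b 0 = cut a b := Fin.ext (by simp)
    rw [← e]
    exact (h₂.preconnected i 0).map
      ⟨right a b, fun h => glue_adj.2 (Or.inr (Or.inl ⟨_, _, h, rfl, rfl⟩))⟩
  have key : ∀ u, (glue G₁ G₂).Reachable u (cut a b) := by
    intro u
    by_cases h0 : u.val = 0
    · obtain rfl : u = 0 := Fin.ext h0
      exact ((glue_adj_zero _).2 rfl).reachable
    · by_cases hu : u.val ≤ a + 1
      · obtain ⟨i, rfl⟩ := exists_left (by omega) hu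
        exact hl i
      · obtain ⟨i, rfl⟩ := exists_right (u := u) (by omega)
        exact hr i
  exact ⟨fun u v => (key u).trans (key v).symm⟩

lemma isTree_glue {G₁ : SimpleGraph (Fin (a + 1))} {G₂ : SimpleGraph (Fin (b + 1))}
    (h₁ : G₁.IsTree) (h₂ : G₂.IsTree) : (glue G₁ G₂).IsTree := by
  refine (connected_glue h₁.connected h₂.connected).isTree_of_ncard_edgeSet_le ?_
  have c₁ := h₁.ncard_edgeSet_add_one
  have c₂ := h₂.ncard_edgeSet_add_one
  have e : (glue G₁ G₂).edgeSet =
      (left a b).sym2Map '' G₁.edgeSet ∪ (right a b).sym2Map '' G₂.edgeSet ∪ {s(0, cut a b)} := by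
    rw [glue, SimpleGraph.edgeSet_sup, SimpleGraph.edgeSet_sup, SimpleGraph.edgeSet_map,
      SimpleGraph.edgeSet_map, SimpleGraph.edgeSet_edge_of_ne zero_ne_cut]
  have d₁ := Set.ncard_union_le
    ((left a b).sym2Map '' G₁.edgeSet ∪ (right a b).sym2Map '' G₂.edgeSet) {s(0, cut a b)}
  have d₂ := Set.ncard_union_le
    ((left a b).sym2Map '' G₁.edgeSet) ((right a b).sym2Map '' G₂.edgeSet)
  rw [Set.ncard_image_of_injective _ (Function.Embedding.injective _),
    Set.ncard_image_of_injective _ (Function.Embedding.injective _)] at d₂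
  rw [Set.ncard_singleton] at d₁
  rw [e]
  simp only [Nat.card_eq_fintype_card, Fintype.card_fin] at *
  omega

section Cut

variable {G : SimpleGraph (Fin (a + b + 2))} (hG : NoncrossingFin G)
  (h0 : ∀ v, G.Adj 0 v ↔ v = cut a b)

include hG h0

lemma adj_cases {u v : Fin (a + b + 2)} (h : G.Adj u v) :
    (u = 0 ∧ v = cut a b ∨ u = cut a b ∧ v = 0) ∨
      (1 ≤ u.val ∧ u.val ≤ a + 1 ∧ 1 ≤ v.val ∧ v.val ≤ a + 1) ∨
      (a + 1 ≤ u.val ∧ a + 1 ≤ v.val) := by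
  by_cases hu : u = 0
  · subst hu
    exact Or.inl (Or.inl ⟨rfl, (h0 v).1 h⟩)
  by_cases hv : v = 0
  · subst hv
    exact Or.inl (Or.inr ⟨(h0 u).1 h.symm, rfl⟩)
  have h1 := hG 0 (cut a b) u v ((h0 _).2 rfl) h
  have h2 := hG 0 (cut a b) v u ((h0 _).2 rfl) h.symm
  simp only [Fin.ext_iff, Fin.val_zero, cut_val] at *
  omega

lemma glue_comap : glue (G.comap (left a b)) (G.comap (right a b)) = G := by
  ext u v
  rw [glue_adj]
  constructor
  · rintro (⟨i, j, h, rfl, rfl⟩ | ⟨i, j, h, rfl, rfl⟩ | ⟨rfl, rfl⟩ | ⟨rfl, rfl⟩)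
    · exact h
    · exact h
    · exact (h0 _).2 rfl
    · exact ((h0 _).2 rfl).symm
  · intro h
    rcases adj_cases hG h0 h with h' | ⟨h₁, h₂, h₃, h₄⟩ | ⟨h₁, h₂⟩
    · exact Or.inr (Or.inr h')
    · obtain ⟨i, rfl⟩ := exists_left h₁ h₂
      obtain ⟨j, rfl⟩ := exists_left h₃ h₄
      exact Or.inl ⟨i, j, h, rfl, rfl⟩
    · obtain ⟨i, rfl⟩ := exists_right h₁
      obtain ⟨j, rfl⟩ := exists_right h₂
      exact Or.inr (Or.inl ⟨i, j, h, rfl, rfl⟩)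

lemma connected_comap_left (hc : G.Connected) : (G.comap (left a b)).Connected := by
  let r : Fin (a + b + 2) → Fin (a + 1) := fun v =>
    if h : 1 ≤ v.val ∧ v.val ≤ a + 1 then ⟨v - 1, by omega⟩ else Fin.last a
  have hr : ∀ i, r (left a b i) = i := fun i => by
    have h : 1 ≤ (left a b i).val ∧ (left a b i).val ≤ a + 1 := by
      rw [left_val]
      omega
    exact (dif_pos h).trans (Fin.ext (by simp))
  have hlast : ∀ v : Fin (a + b + 2), v.val = 0 ∨ a + 1 ≤ v.val → r v = Fin.last a := by
    intro v hv
    simp only [r]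
    split_ifs
    · exact Fin.ext (by simp; omega)
    · rfl
  refine hc.of_surjective_of_adj r (fun i => ⟨_, hr i⟩) fun u v h => ?_
  rcases adj_cases hG h0 h with (⟨rfl, rfl⟩ | ⟨rfl, rfl⟩) | ⟨h₁, h₂, h₃, h₄⟩ | ⟨h₁, h₂⟩
  · left; rw [hlast _ (by simp), hlast _ (by simp)]
  · left; rw [hlast _ (by simp), hlast _ (by simp)]
  · obtain ⟨i, rfl⟩ := exists_left h₁ h₂
    obtain ⟨j, rfl⟩ := exists_left h₃ h₄
    right
    rwa [hr, hr]
  · left; rw [hlast _ (Or.inr h₁), hlast _ (Or.inr h₂)]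

lemma connected_comap_right (hc : G.Connected) : (G.comap (right a b)).Connected := by
  let r : Fin (a + b + 2) → Fin (b + 1) := fun v => ⟨v - (a + 1), by omega⟩
  have hr : ∀ i, r (right a b i) = i := fun i => by simp [r]
  have hzero : ∀ v : Fin (a + b + 2), v.val ≤ a + 1 → r v = 0 :=
    fun v hv => Fin.ext (by simp [r]; omega)
  refine hc.of_surjective_of_adj r (fun i => ⟨_, hr i⟩) fun u v h => ?_
  rcases adj_cases hG h0 h with (⟨rfl, rfl⟩ | ⟨rfl, rfl⟩) | ⟨h₁, h₂, h₃, h₄⟩ | ⟨h₁, h₂⟩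
  · left; rw [hzero _ (by simp), hzero _ (by simp)]
  · left; rw [hzero _ (by simp), hzero _ (by simp)]
  · left; rw [hzero _ h₂, hzero _ h₄]
  · obtain ⟨i, rfl⟩ := exists_right h₁
    obtain ⟨j, rfl⟩ := exists_right h₂
    right
    rwa [hr, hr]

end Cut

lemma noncrossing_comap {m n : ℕ} {G : SimpleGraph (Fin n)} (hG : NoncrossingFin G)
    {f : Fin m → Fin n} (hf : StrictMono f) : NoncrossingFin (G.comap f) :=
  fun _ _ _ _ h h' ⟨h₁, h₂, h₃⟩ => hG _ _ _ _ h h' ⟨hf h₁, hf h₂, hf h₃⟩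

lemma left_strictMono : StrictMono (left a b) := fun _ _ h => Nat.add_lt_add_right h _

lemma right_strictMono : StrictMono (right a b) := fun _ _ h => Nat.add_lt_add_right h _

/-- Cutting a noncrossing tree in which `0` is a leaf at the neighbour of `0`. -/
def cutEquiv (a b : ℕ) :
    {G : SimpleGraph (Fin (a + b + 2)) //
      (G.IsTree ∧ NoncrossingFin G) ∧ ∀ v, G.Adj 0 v ↔ v = cut a b} ≃
    {G : SimpleGraph (Fin (a + 1)) // G.IsTree ∧ NoncrossingFin G} ×
      {G : SimpleGraph (Fin (b + 1)) // G.IsTree ∧ NoncrossingFin G} where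
  toFun G :=
    (⟨G.1.comap (left a b), ⟨connected_comap_left G.2.1.2 G.2.2 G.2.1.1.connected,
        G.2.1.1.isAcyclic.comap (SimpleGraph.Hom.comap _ _) (left a b).injective⟩,
        noncrossing_comap G.2.1.2 left_strictMono⟩,
      ⟨G.1.comap (right a b), ⟨connected_comap_right G.2.1.2 G.2.2 G.2.1.1.connected,
        G.2.1.1.isAcyclic.comap (SimpleGraph.Hom.comap _ _) (right a b).injective⟩,
        noncrossing_comap G.2.1.2 right_strictMono⟩)
  invFun p := ⟨glue p.1.1 p.2.1,
    ⟨isTree_glue p.1.2.1 p.2.2.1, noncrossing_glue p.1.2.2 p.2.2.2⟩, glue_adj_zero⟩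
  left_inv G := Subtype.ext (glue_comap G.2.1.2 G.2.2)
  right_inv _ := Prod.ext (Subtype.ext (comap_left_glue _ _)) (Subtype.ext (comap_right_glue _ _))

lemma card_adj_zero_iff {n : ℕ} (k : Fin (n + 1)) :
    Nat.card {G : SimpleGraph (ZMod (n + 2)) //
      IsNCTree G ∧ ∀ v, G.Adj 0 v ↔ v = (k.succ : Fin (n + 2))} =
      A (k + 1) * A (n + 1 - k) := by
  obtain ⟨a, ha⟩ := k
  obtain ⟨b, rfl⟩ := Nat.exists_eq_add_of_le (Nat.le_of_lt_succ ha)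
  have hb : a + b + 1 - a = b + 1 := by omega
  simp only [hb]
  exact (Nat.card_congr (cutEquiv a b)).trans (Nat.card_prod _ _)

/-- Noncrossing trees in which `0` is a leaf, sorted by the neighbour of `0`. -/
noncomputable def leafEquiv (n : ℕ) :
    {G : SimpleGraph (ZMod (n + 2)) // IsNCTree G ∧ (G.neighborSet 0).ncard = 1} ≃
    Σ k : Fin (n + 1), {G : SimpleGraph (ZMod (n + 2)) //
      IsNCTree G ∧ ∀ v, G.Adj 0 v ↔ v = (k.succ : Fin (n + 2))} :=
  (Equiv.ofBijective (fun x => ⟨x.2.1, x.2.2.1, Set.ncard_eq_one.2 ⟨x.1.succ, Set.ext x.2.2.2⟩⟩) <| by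
    constructor
    · rintro ⟨k, G, hG, hk⟩ ⟨l, G', hG', hl⟩ h
      obtain rfl : G = G' := congrArg Subtype.val h
      obtain rfl : k = l := Fin.succ_injective _ ((hl _).1 ((hk _).2 rfl))
      rfl
    · rintro ⟨G, hG, h⟩
      obtain ⟨v, hv⟩ := Set.ncard_eq_one.1 h
      have hv' : ∀ w, G.Adj 0 w ↔ w = v := fun w => Set.ext_iff.1 hv w
      obtain ⟨k, rfl⟩ := Fin.exists_succ_eq.2 (show (v : Fin (n + 2)) ≠ 0 from
        ((hv' v).2 rfl).ne')
      exact ⟨⟨k, G, hG, hv'⟩, rfl⟩).symm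

lemma A₁_one : A₁ 1 = 0 := by
  have : IsEmpty {G : SimpleGraph (ZMod 1) // IsNCTree G ∧ (G.neighborSet 0).ncard = 1} := by
    refine ⟨fun ⟨G, _, h⟩ => ?_⟩
    obtain ⟨v, hv⟩ := Set.ncard_eq_one.1 h
    have hadj : G.Adj 0 v := (Set.ext_iff.1 hv v).2 rfl
    exact hadj.ne (Subsingleton.elim (α := Fin 1) _ _)
  exact Nat.card_of_isEmpty

end NCTree

theorem A₁_recurrence :
    A₁ 1 = 0 ∧
    ∀ n : ℕ, 2 ≤ n → A₁ n = ∑ j ∈ Finset.Icc 2 n, A (j - 1) * A (n + 1 - j) := by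
  refine ⟨NCTree.A₁_one, fun n hn => ?_⟩
  obtain ⟨n, rfl⟩ := Nat.exists_eq_add_of_le' hn
  have : Finite (SimpleGraph (ZMod (n + 2))) := inferInstanceAs (Finite (SimpleGraph (Fin (n + 2))))
  rw [A₁, Nat.card_congr (NCTree.leafEquiv n), Nat.card_sigma,
    Finset.sum_congr rfl fun k _ => NCTree.card_adj_zero_iff k,
    ← Finset.sum_range fun k => A (k + 1) * A (n + 1 - k),
    ← Finset.Ico_add_one_right_eq_Icc, Finset.sum_Ico_eq_sum_range]
  refine Finset.sum_congr (by congr 1) fun k _ => ?_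
  congr 2 <;> omega
end

section
/- For every integer n ≥ 1, the number A(n) of n-noncrossing trees equals (1/(2n−1))·binom(3n−3, n−1); equivalently, (2n−1)·A(n) = binom(3n−3, n−1). -/
namespace TernarySeries

open PowerSeries

theorem differential_identity {R : Type*} [CommRing R] {z T T₁ T₂ : R}
    (h : T = 1 + z * T ^ 3)
    (h₁ : (1 - 3 * z * T ^ 2) * T₁ = T ^ 3)
    (h₂ : (1 - 3 * z * T ^ 2) * T₂ = 6 * T ^ 2 * T₁ + 6 * z * T * T₁ ^ 2) :
    (1 - 3 * z * T ^ 2) ^ 3 *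
      ((4 * z - 27 * z ^ 2) * T₂ + (6 - 54 * z) * T₁ - 6 * T) = 0 := by
  linear_combination
    (4 * z - 27 * z ^ 2) * (1 - 3 * z * T ^ 2) ^ 2 * h₂ +
    (4 * z - 27 * z ^ 2) * (6 * T ^ 2 * (1 - 3 * z * T ^ 2) +
      6 * z * T * ((1 - 3 * z * T ^ 2) * T₁ + T ^ 3)) * h₁ +
    (6 - 54 * z) * (1 - 3 * z * T ^ 2) ^ 2 * h₁ +
    6 * T * (27 * (z * T ^ 2) ^ 2 * (1 - 2 * (z * T ^ 2)) +
      (1 - 3 * (z * T ^ 2)) ^ 2 * (1 + 6 * (z * T ^ 2))) * (T - z * T ^ 3 + 1) * h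

theorem ode {T : ℚ⟦X⟧} (h : T = 1 + X * T ^ 3) :
    (4 * X - 27 * X ^ 2) * d⁄dX ℚ (d⁄dX ℚ T) + (6 - 54 * X) * d⁄dX ℚ T - 6 * T = 0 := by
  have h₁ : (1 - 3 * X * T ^ 2) * d⁄dX ℚ T = T ^ 3 := by
    have := congrArg (d⁄dX ℚ) h
    simp only [map_add, derivative_one, Derivation.leibniz, Derivation.leibniz_pow, derivative_X,
      smul_eq_mul, nsmul_eq_mul] at this
    push_cast at this
    linear_combination this
  have h₂ : (1 - 3 * X * T ^ 2) * d⁄dX ℚ (d⁄dX ℚ T) =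
      6 * T ^ 2 * d⁄dX ℚ T + 6 * X * T * d⁄dX ℚ T ^ 2 := by
    have h3 : d⁄dX ℚ (3 : ℚ⟦X⟧) = 0 := by
      rw [← map_ofNat (C : ℚ →+* ℚ⟦X⟧) 3, derivative_C]
    have := congrArg (d⁄dX ℚ) h₁
    simp only [map_sub, derivative_one, Derivation.leibniz, Derivation.leibniz_pow, derivative_X,
      smul_eq_mul, nsmul_eq_mul, h3] at this
    push_cast at this
    linear_combination this
  refine (mul_eq_zero.1 (differential_identity h h₁ h₂)).resolve_left (pow_ne_zero 3 fun h0 ↦ ?_)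
  simpa using congrArg constantCoeff h0

theorem coeff_recurrence {t : ℕ → ℚ} (h : PowerSeries.mk t = 1 + X * PowerSeries.mk t ^ 3)
    (m : ℕ) :
    (2 * m + 2) * (2 * m + 3) * t (m + 1) = 3 * (3 * m + 1) * (3 * m + 2) * t m := by
  have key := ode h
  have h' : X * (C 4 * d⁄dX ℚ (d⁄dX ℚ (PowerSeries.mk t)))
      - X * (X * (C 27 * d⁄dX ℚ (d⁄dX ℚ (PowerSeries.mk t))))
      + C 6 * d⁄dX ℚ (PowerSeries.mk t) - X * (C 54 * d⁄dX ℚ (PowerSeries.mk t))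
      - C 6 * PowerSeries.mk t = 0 := by
    simp only [map_ofNat]
    linear_combination key
  have hm := congrArg (coeff m) h'
  rcases m with _ | _ | m <;>
  · simp only [map_add, map_sub, coeff_zero_X_mul, coeff_succ_X_mul, coeff_C_mul,
      coeff_derivative, coeff_mk, map_zero] at hm
    push_cast at hm ⊢
    linear_combination hm

theorem coeff_closed_form {t : ℕ → ℕ} (h0 : t 0 = 1)
    (hs : ∀ m, t (m + 1) = ∑ p ∈ Finset.HasAntidiagonal.antidiagonal m,
      (∑ q ∈ Finset.HasAntidiagonal.antidiagonal p.1, t q.1 * t q.2) * t p.2) (m : ℕ) :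
    (2 * m + 1) * t m = (3 * m).choose m := by
  have h : PowerSeries.mk (fun m ↦ (t m : ℚ)) =
      1 + X * PowerSeries.mk (fun m ↦ (t m : ℚ)) ^ 3 := by
    ext m
    rcases m with _ | m
    · simp [h0]
    · rw [map_add, coeff_succ_X_mul, pow_succ, pow_two, coeff_mul]
      simp [coeff_mul, hs, coeff_one]
  have key (m : ℕ) : (t m : ℚ) * (2 * m + 1).factorial * m.factorial = (3 * m).factorial := by
    induction m with
    | zero => simp [h0]
    | succ m ih =>
      have hr := coeff_recurrence h m
      have e1 : 2 * (m + 1) + 1 = 2 * m + 1 + 1 + 1 := by ring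
      have e2 : 3 * (m + 1) = 3 * m + 1 + 1 + 1 := by ring
      rw [e1, e2]
      simp only [Nat.factorial_succ] at ih ⊢
      push_cast at ih ⊢
      linear_combination (3 * (m + 1) * (3 * m + 1) * (3 * m + 2) : ℚ) * ih +
        ((m + 1) * (2 * m + 1) * (2 * m).factorial * m.factorial : ℚ) * hr
  have hk : t m * (2 * m + 1).factorial * m.factorial = (3 * m).factorial := by
    exact_mod_cast key m
  have hc := Nat.choose_mul_factorial_mul_factorial (show m ≤ 3 * m by omega)
  rw [show 3 * m - m = 2 * m by omega] at hc
  refine Nat.eq_of_mul_eq_mul_right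
    (Nat.mul_pos m.factorial_pos (2 * m).factorial_pos) ?_
  rw [← mul_assoc (Nat.choose _ _), hc, ← hk, Nat.factorial_succ]
  ring

end TernarySeries

namespace SimpleGraph

variable {V W : Type*} {G : SimpleGraph V} {H : SimpleGraph W}

theorem Reachable.induction_closed {P : V → Prop} (hP : ∀ x y, G.Adj x y → P x → P y) {x y : V}
    (h : G.Reachable x y) (hx : P x) : P y := by
  obtain ⟨w⟩ := h
  induction w with
  | nil => exact hx
  | cons hadj _ ih => exact ih (hP _ _ hadj hx)

theorem Reachable.of_collapse (r : V → W)
    (hr : ∀ u v, G.Adj u v → r u = r v ∨ H.Adj (r u) (r v)) {x y : V}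
    (h : G.Reachable x y) : H.Reachable (r x) (r y) := by
  refine h.induction_closed (P := fun z ↦ H.Reachable (r x) (r z)) (fun u v huv hu ↦ ?_) .rfl
  rcases hr u v huv with h | h
  · exact h ▸ hu
  · exact hu.trans h.reachable

theorem IsBridge.of_collapse (r : V → W) {x y : V}
    (hr : ∀ u v, G.Adj u v → r u = r v ∨
      H.Adj (r u) (r v) ∧ (s(r u, r v) = s(r x, r y) → s(u, v) = s(x, y)))
    (hb : H.IsBridge s(r x, r y)) : G.IsBridge s(x, y) := by
  rw [isBridge_iff] at hb ⊢
  refine fun h ↦ hb (h.of_collapse r fun u v huv ↦ ?_)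
  rw [deleteEdges_adj, Set.mem_singleton_iff] at huv
  refine (hr u v huv.1).imp_right fun h ↦ ?_
  rw [deleteEdges_adj, Set.mem_singleton_iff]
  exact ⟨h.1, fun h' ↦ huv.2 (h.2 h')⟩

end SimpleGraph

open SimpleGraph

/-- `NCTreeOn a b G` says that the edges of `G` form a noncrossing tree with vertex set the
interval `[a, b]`. -/
structure NCTreeOn (a b : ℕ) (G : SimpleGraph ℕ) : Prop where
  left_le {x y : ℕ} (h : G.Adj x y) : a ≤ x
  le_right {x y : ℕ} (h : G.Adj x y) : x ≤ b
  reachable {x : ℕ} (hax : a ≤ x) (hxb : x ≤ b) : G.Reachable a x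
  acyclic : G.IsAcyclic
  noncrossing {x y u v : ℕ} (hxy : G.Adj x y) (huv : G.Adj u v) : ¬(x < u ∧ u < y ∧ y < v)

/-- The union of three graphs and one additional edge `{a, k}`. -/
def glue (a k : ℕ) (G₁ G₂ G₃ : SimpleGraph ℕ) : SimpleGraph ℕ :=
  G₁ ⊔ G₂ ⊔ G₃ ⊔ edge a k

/-- The edges of `G` with both ends in `[c, d]`. -/
def restrictIcc (G : SimpleGraph ℕ) (c d : ℕ) : SimpleGraph ℕ where
  Adj x y := G.Adj x y ∧ (c ≤ x ∧ x ≤ d) ∧ c ≤ y ∧ y ≤ d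
  symm := ⟨fun _ _ h ↦ ⟨h.1.symm, h.2.2, h.2.1⟩⟩
  loopless := ⟨fun _ h ↦ h.1.ne rfl⟩

/-- Noncrossing trees on `[a, j]`, `[j + 1, k]` and `[k, b]`. -/
structure IsSplit (a j k b : ℕ) (G₁ G₂ G₃ : SimpleGraph ℕ) : Prop where
  le : a ≤ j
  lt : j < k
  le' : k ≤ b
  fst : NCTreeOn a j G₁
  snd : NCTreeOn (j + 1) k G₂
  trd : NCTreeOn k b G₃

namespace NCTreeOn

variable {a b : ℕ} {G : SimpleGraph ℕ}

theorem bounds (h : NCTreeOn a b G) {x y : ℕ} (hxy : G.Adj x y) :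
    (a ≤ x ∧ x ≤ b) ∧ a ≤ y ∧ y ≤ b :=
  ⟨⟨h.left_le hxy, h.le_right hxy⟩, h.left_le hxy.symm, h.le_right hxy.symm⟩

theorem isBridge (h : NCTreeOn a b G) {x y : ℕ} (hxy : G.Adj x y) : G.IsBridge s(x, y) :=
  isAcyclic_iff_forall_adj_isBridge.1 h.acyclic hxy

theorem self_iff : NCTreeOn a a G ↔ G = ⊥ := by
  constructor
  · intro h
    ext x y
    simp only [bot_adj, iff_false]
    intro hxy
    have := h.bounds hxy
    exact hxy.ne (by omega)
  · rintro rfl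
    exact ⟨by simp, by simp, fun h h' ↦ le_antisymm h h' ▸ .rfl, isAcyclic_bot, by simp⟩

theorem finite_setOf (a b : ℕ) : {G | NCTreeOn a b G}.Finite := by
  have hF : ((Finset.Icc a b).sym2 : Set (Sym2 ℕ)).Finite := Finset.finite_toSet _
  refine (hF.finite_subsets.preimage edgeSet_injective.injOn).subset fun G hG ↦ ?_
  intro e
  induction e with
  | _ x y =>
    intro h
    simpa using hG.bounds h

end NCTreeOn

theorem glue_adj {a k : ℕ} (h : a < k) {G₁ G₂ G₃ : SimpleGraph ℕ} {x y : ℕ} :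
    (glue a k G₁ G₂ G₃).Adj x y ↔
      G₁.Adj x y ∨ G₂.Adj x y ∨ G₃.Adj x y ∨ (x = a ∧ y = k ∨ x = k ∧ y = a) := by
  simp only [glue, sup_adj, edge_adj, or_assoc]
  refine or_congr_right (or_congr_right (or_congr_right ?_))
  omega

namespace IsSplit

variable {a j k b : ℕ} {G₁ G₂ G₃ : SimpleGraph ℕ}

theorem glue_adj_iff (h : IsSplit a j k b G₁ G₂ G₃) {x y : ℕ} :
    (glue a k G₁ G₂ G₃).Adj x y ↔
      G₁.Adj x y ∨ G₂.Adj x y ∨ G₃.Adj x y ∨ (x = a ∧ y = k ∨ x = k ∧ y = a) :=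
  glue_adj (h.le.trans_lt h.lt)

theorem fst_adj_iff (h : IsSplit a j k b G₁ G₂ G₃) {x y : ℕ} :
    G₁.Adj x y ↔ (restrictIcc (glue a k G₁ G₂ G₃) a j).Adj x y := by
  have h1 := h.le
  have h2 := h.lt
  refine ⟨fun hxy ↦ ⟨h.glue_adj_iff.2 (.inl hxy), h.fst.bounds hxy⟩, fun ⟨hxy, hb⟩ ↦ ?_⟩
  rcases h.glue_adj_iff.1 hxy with h' | h' | h' | h'
  · exact h'
  · have := h.snd.bounds h'; omega
  · have := h.trd.bounds h'; omega
  · omega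

theorem snd_adj_iff (h : IsSplit a j k b G₁ G₂ G₃) {x y : ℕ} :
    G₂.Adj x y ↔ (restrictIcc (glue a k G₁ G₂ G₃) (j + 1) k).Adj x y := by
  have h1 := h.le
  have h2 := h.lt
  refine ⟨fun hxy ↦ ⟨h.glue_adj_iff.2 (.inr (.inl hxy)), h.snd.bounds hxy⟩, fun ⟨hxy, hb⟩ ↦ ?_⟩
  rcases h.glue_adj_iff.1 hxy with h' | h' | h' | h'
  · have := h.fst.bounds h'; omega
  · exact h'
  · have := h.trd.bounds h'
    exact absurd (show x = y by omega) hxy.ne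
  · omega

theorem trd_adj_iff (h : IsSplit a j k b G₁ G₂ G₃) {x y : ℕ} :
    G₃.Adj x y ↔ (restrictIcc (glue a k G₁ G₂ G₃) k b).Adj x y := by
  have h1 := h.le
  have h2 := h.lt
  refine ⟨fun hxy ↦ ⟨h.glue_adj_iff.2 (.inr (.inr (.inl hxy))), h.trd.bounds hxy⟩,
    fun ⟨hxy, hb⟩ ↦ ?_⟩
  rcases h.glue_adj_iff.1 hxy with h' | h' | h' | h'
  · have := h.fst.bounds h'; omega
  · have := h.snd.bounds h'
    exact absurd (show x = y by omega) hxy.ne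
  · exact h'
  · omega

theorem glue_noncrossing (h : IsSplit a j k b G₁ G₂ G₃) {x y u v : ℕ}
    (hxy : (glue a k G₁ G₂ G₃).Adj x y) (huv : (glue a k G₁ G₂ G₃).Adj u v) :
    ¬(x < u ∧ u < y ∧ y < v) := by
  have h1 := h.le
  have h2 := h.lt
  rcases h.glue_adj_iff.1 hxy with hxy | hxy | hxy | hxy <;>
    rcases h.glue_adj_iff.1 huv with huv | huv | huv | huv
  · exact h.fst.noncrossing hxy huv
  · have := h.fst.bounds hxy; have := h.snd.bounds huv; omega
  · have := h.fst.bounds hxy; have := h.trd.bounds huv; omega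
  · have := h.fst.bounds hxy; omega
  · have := h.snd.bounds hxy; have := h.fst.bounds huv; omega
  · exact h.snd.noncrossing hxy huv
  · have := h.snd.bounds hxy; have := h.trd.bounds huv; omega
  · have := h.snd.bounds hxy; omega
  · have := h.trd.bounds hxy; have := h.fst.bounds huv; omega
  · have := h.trd.bounds hxy; have := h.snd.bounds huv; omega
  · exact h.trd.noncrossing hxy huv
  · have := h.trd.bounds hxy; omega
  · have := h.fst.bounds huv; omega
  · have := h.snd.bounds huv; omega
  · have := h.trd.bounds huv; omega
  · omega

theorem isAcyclic_glue (h : IsSplit a j k b G₁ G₂ G₃) : (glue a k G₁ G₂ G₃).IsAcyclic := by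
  have h1 := h.le
  have h2 := h.lt
  have hedge : (glue a k G₁ G₂ G₃).IsBridge s(a, k) := by
    rw [isBridge_iff]
    intro hr
    refine h2.not_ge (hr.induction_closed (P := fun v ↦ v ≤ j) (fun x y hxy hx ↦ ?_) h1)
    rw [deleteEdges_adj, Set.mem_singleton_iff, h.glue_adj_iff] at hxy
    obtain ⟨h' | h' | h' | h', hne⟩ := hxy
    · have := h.fst.bounds h'; omega
    · have := h.snd.bounds h'; omega
    · have := h.trd.bounds h'; omega
    · exact absurd (Sym2.eq_iff.2 h') hne
  rw [isAcyclic_iff_forall_adj_isBridge]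
  intro x y hxy
  rcases h.glue_adj_iff.1 hxy with hxy | hxy | hxy | hxy
  · have hb := h.fst.bounds hxy
    have key := h.fst.isBridge hxy
    refine IsBridge.of_collapse (H := G₁) (fun v ↦ if v ≤ j then v else a) (fun u v huv ↦ ?_)
      (by simpa [hb] using key)
    rcases h.glue_adj_iff.1 huv with h' | h' | h' | h'
    · have := h.fst.bounds h'
      exact .inr (by simp [hb, this, h'])
    · have := h.snd.bounds h'; left; grind
    · have := h.trd.bounds h'; left; grind
    · left; grind
  · have hb := h.snd.bounds hxy
    have key := h.snd.isBridge hxy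
    refine IsBridge.of_collapse (H := G₂) (fun v ↦ if j + 1 ≤ v ∧ v ≤ k then v else k)
      (fun u v huv ↦ ?_) (by simpa only [hb, and_self, if_true] using key)
    rcases h.glue_adj_iff.1 huv with h' | h' | h' | h'
    · have := h.fst.bounds h'; left; grind
    · have := h.snd.bounds h'
      exact .inr (by simp only [hb, this, h', and_self, if_true, imp_self])
    · have := h.trd.bounds h'; left; grind
    · left; grind
  · have hb := h.trd.bounds hxy
    have key := h.trd.isBridge hxy
    refine IsBridge.of_collapse (H := G₃) (fun v ↦ if k ≤ v then v else k) (fun u v huv ↦ ?_)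
      (by simpa [hb] using key)
    rcases h.glue_adj_iff.1 huv with h' | h' | h' | h'
    · have := h.fst.bounds h'; left; grind
    · have := h.snd.bounds h'; left; grind
    · have := h.trd.bounds h'
      exact .inr (by simp [hb, this, h'])
    · left; grind
  · rwa [Sym2.eq_iff.2 hxy]

theorem ncTreeOn_glue (h : IsSplit a j k b G₁ G₂ G₃) : NCTreeOn a b (glue a k G₁ G₂ G₃) := by
  have h1 := h.le
  have h2 := h.lt
  have h3 := h.le'
  have hb {x y : ℕ} (hxy : (glue a k G₁ G₂ G₃).Adj x y) : a ≤ x ∧ x ≤ b := by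
    rcases h.glue_adj_iff.1 hxy with h' | h' | h' | h'
    · have := h.fst.bounds h'; omega
    · have := h.snd.bounds h'; omega
    · have := h.trd.bounds h'; omega
    · omega
  have hl₁ : G₁ ≤ glue a k G₁ G₂ G₃ := fun _ _ h' ↦ h.glue_adj_iff.2 (.inl h')
  have hl₂ : G₂ ≤ glue a k G₁ G₂ G₃ := fun _ _ h' ↦ h.glue_adj_iff.2 (.inr (.inl h'))
  have hl₃ : G₃ ≤ glue a k G₁ G₂ G₃ := fun _ _ h' ↦ h.glue_adj_iff.2 (.inr (.inr (.inl h')))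
  have hak : (glue a k G₁ G₂ G₃).Reachable a k :=
    (h.glue_adj_iff.2 (.inr (.inr (.inr (.inl ⟨rfl, rfl⟩))))).reachable
  refine ⟨fun h ↦ (hb h).1, fun h ↦ (hb h).2, fun {x} hax hxb ↦ ?_, h.isAcyclic_glue,
    h.glue_noncrossing⟩
  rcases le_or_gt x j with hx | hx
  · exact (h.fst.reachable hax hx).mono hl₁
  rcases le_or_gt x k with hx' | hx'
  · have e₁ := (h.snd.reachable hx hx').mono hl₂
    have e₂ := (h.snd.reachable (x := k) h2 le_rfl).mono hl₂
    exact hak.trans (e₂.symm.trans e₁)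
  · exact hak.trans ((h.trd.reachable hx'.le hxb).mono hl₃)

theorem le_of_glue_adj (h : IsSplit a j k b G₁ G₂ G₃) {y : ℕ} (hy : (glue a k G₁ G₂ G₃).Adj a y) :
    y ≤ k := by
  have h1 := h.le
  have h2 := h.lt
  rcases h.glue_adj_iff.1 hy with h' | h' | h' | h'
  · have := h.fst.bounds h'; omega
  · have := h.snd.bounds h'; omega
  · have := h.trd.bounds h'; omega
  · omega

theorem glue_adj_root (h : IsSplit a j k b G₁ G₂ G₃) : (glue a k G₁ G₂ G₃).Adj a k :=
  h.glue_adj_iff.2 (.inr (.inr (.inr (.inl ⟨rfl, rfl⟩))))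

variable {j' k' : ℕ} {G₁' G₂' G₃' : SimpleGraph ℕ}

theorem le_of_glue_eq (h : IsSplit a j k b G₁ G₂ G₃) (h' : IsSplit a j' k b G₁' G₂' G₃')
    (heq : glue a k G₁ G₂ G₃ = glue a k G₁' G₂' G₃') : j' ≤ j := by
  have h1 := h.le
  have h2 := h.lt
  have h2' := h'.lt
  refine (h'.fst.reachable h'.le le_rfl).induction_closed (P := fun v ↦ v ≤ j)
    (fun x y hxy hx ↦ ?_) h1
  have hb := h'.fst.bounds hxy
  have hxy' := (h'.fst_adj_iff.1 hxy).1
  rw [← heq, h.glue_adj_iff] at hxy'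
  rcases hxy' with e | e | e | e
  · have := h.fst.bounds e; omega
  · have := h.snd.bounds e; omega
  · have := h.trd.bounds e; omega
  · omega

theorem glue_inj (h : IsSplit a j k b G₁ G₂ G₃) (h' : IsSplit a j' k' b G₁' G₂' G₃')
    (heq : glue a k G₁ G₂ G₃ = glue a k' G₁' G₂' G₃') :
    j = j' ∧ k = k' ∧ G₁ = G₁' ∧ G₂ = G₂' ∧ G₃ = G₃' := by
  obtain rfl : k = k' :=
    le_antisymm (h'.le_of_glue_adj (heq ▸ h.glue_adj_root)) (h.le_of_glue_adj (heq ▸ h'.glue_adj_root))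
  obtain rfl : j = j' := le_antisymm (h'.le_of_glue_eq h heq.symm) (h.le_of_glue_eq h' heq)
  refine ⟨rfl, rfl, ?_, ?_, ?_⟩ <;> ext x y
  · rw [h.fst_adj_iff, h'.fst_adj_iff, heq]
  · rw [h.snd_adj_iff, h'.snd_adj_iff, heq]
  · rw [h.trd_adj_iff, h'.trd_adj_iff, heq]

end IsSplit

namespace NCTreeOn

variable {a b : ℕ} {G : SimpleGraph ℕ}

theorem exists_greatest_neighbor (h : NCTreeOn a b G) (hab : a < b) :
    ∃ k, G.Adj a k ∧ ∀ y, G.Adj a y → y ≤ k := by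
  have hne : {y | G.Adj a y}.Nonempty := by
    obtain ⟨w⟩ := h.reachable hab.le le_rfl
    cases w with
    | nil => exact absurd hab (lt_irrefl _)
    | cons hadj _ => exact ⟨_, hadj⟩
  have hbdd : BddAbove {y | G.Adj a y} := ⟨b, fun y hy ↦ (h.bounds hy).2.2⟩
  exact ⟨sSup {y | G.Adj a y}, Nat.sSup_mem hne hbdd, fun y hy ↦ le_csSup hbdd hy⟩

theorem exists_cut (h : NCTreeOn a b G) {k : ℕ} (hk : G.Adj a k)
    (hmax : ∀ y, G.Adj a y → y ≤ k) :
    ∃ j, a ≤ j ∧ j < k ∧ ∀ x y, G.Adj x y → x < y → x = a ∧ y = k ∨ y ≤ j ∨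
      j + 1 ≤ x ∧ y ≤ k ∨ k ≤ x := by
  have hak : a < k := lt_of_le_of_ne (h.bounds hk).2.1 hk.ne
  set H := G.deleteEdges {s(a, k)} with hH
  have hHadj {x y : ℕ} : H.Adj x y ↔ G.Adj x y ∧ ¬(x = a ∧ y = k ∨ x = k ∧ y = a) := by
    rw [hH, deleteEdges_adj, Set.mem_singleton_iff, Sym2.eq_iff]
  have hbridge : ¬H.Reachable a k := isBridge_iff.1 (h.isBridge hk)
  let S : Set ℕ := {v | v ≤ k ∧ H.Reachable a v}
  have hSb : BddAbove S := ⟨k, fun v hv ↦ hv.1⟩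
  have haS : a ∈ S := ⟨hak.le, .rfl⟩
  obtain ⟨hjk, hj⟩ : sSup S ∈ S := Nat.sSup_mem ⟨a, haS⟩ hSb
  have hS {v : ℕ} (hv : v ≤ k) (hr : H.Reachable a v) : v ≤ sSup S := le_csSup hSb ⟨hv, hr⟩
  have haj := le_csSup hSb haS
  generalize sSup S = j at *
  have hjk' : j < k := lt_of_le_of_ne hjk fun e ↦ hbridge (e ▸ hj)
  refine ⟨j, haj, hjk', fun x y hxy hlt ↦ ?_⟩
  by_contra! hcon
  obtain ⟨c1, c2, c3, c4⟩ := hcon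
  have hax := h.left_le hxy
  have hyk : y ≤ k := by
    rcases hax.eq_or_lt with rfl | hax
    · exact hmax y hxy
    · have := h.noncrossing hk hxy
      omega
  have hxyH : H.Adj x y := hHadj.2 ⟨hxy, by omega⟩
  have hy : ¬H.Reachable a y := fun hr ↦ by have := hS hyk hr; omega
  have hx : ¬H.Reachable a x := fun hr ↦ hy (hr.trans hxyH.reachable)
  have hxj : x < j := by
    have : x ≠ j := fun e ↦ hx (e ▸ hj)
    omega
  have key := hj.induction_closed (P := fun v ↦ H.Reachable a v ∧ ¬(x < v ∧ v < y))
    (fun u v huv ⟨hu, hu'⟩ ↦ ?_) ⟨.rfl, by omega⟩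
  · omega
  · have hv := hu.trans huv.reachable
    refine ⟨hv, fun hv' ↦ ?_⟩
    have : u ≠ x := fun e ↦ hx (e ▸ hu)
    have : u ≠ y := fun e ↦ hy (e ▸ hu)
    have := h.noncrossing (hHadj.1 huv).1 hxy
    have := h.noncrossing hxy (hHadj.1 huv).1.symm
    omega

theorem restrictIcc_of_collapse (h : NCTreeOn a b G) {c d : ℕ} (r : ℕ → ℕ) (hac : a ≤ c)
    (hcd : c ≤ d) (hdb : d ≤ b) (hid : ∀ v, c ≤ v → v ≤ d → r v = v)
    (hr : ∀ u v, G.Adj u v → u < v → r u = r v ∨ (c ≤ u ∧ v ≤ d)) :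
    NCTreeOn c d (restrictIcc G c d) := by
  have hle : restrictIcc G c d ≤ G := fun _ _ h ↦ h.1
  refine ⟨fun h ↦ h.2.1.1, fun h ↦ h.2.1.2, fun {x} hcx hxd ↦ ?_, h.acyclic.anti hle,
    fun h₁ h₂ ↦ h.noncrossing h₁.1 h₂.1⟩
  have key := ((h.reachable hac (hcd.trans hdb)).symm.trans
    (h.reachable (hac.trans hcx) (hxd.trans hdb))).of_collapse (H := restrictIcc G c d) r
    fun u v huv ↦ ?_
  · rwa [hid c le_rfl hcd, hid x hcx hxd] at key
  · rcases lt_or_gt_of_ne huv.ne with hlt | hlt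
    · refine (hr u v huv hlt).imp_right fun hb ↦ ?_
      rw [hid u (by omega) (by omega), hid v (by omega) (by omega)]
      exact ⟨huv, by omega, by omega⟩
    · refine (hr v u huv.symm hlt).imp Eq.symm fun hb ↦ ?_
      rw [hid u (by omega) (by omega), hid v (by omega) (by omega)]
      exact ⟨huv, by omega, by omega⟩

theorem exists_isSplit (h : NCTreeOn a b G) (hab : a < b) :
    ∃ j k G₁ G₂ G₃, IsSplit a j k b G₁ G₂ G₃ ∧ glue a k G₁ G₂ G₃ = G := by
  obtain ⟨k, hk, hmax⟩ := h.exists_greatest_neighbor hab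
  obtain ⟨j, haj, hjk, hcut⟩ := h.exists_cut hk hmax
  have hkb := (h.bounds hk).2.2
  refine ⟨j, k, restrictIcc G a j, restrictIcc G (j + 1) k, restrictIcc G k b,
    ⟨haj, hjk, hkb, ?_, ?_, ?_⟩, ?_⟩
  · refine h.restrictIcc_of_collapse (fun v ↦ if v ≤ j then v else a) le_rfl haj (by omega)
      (by grind) fun u v huv hlt ↦ ?_
    have := hcut u v huv hlt
    have := h.bounds huv
    grind
  · refine h.restrictIcc_of_collapse (fun v ↦ if j + 1 ≤ v ∧ v ≤ k then v else k) (by omega) hjk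
      hkb (by grind) fun u v huv hlt ↦ ?_
    have := hcut u v huv hlt
    grind
  · refine h.restrictIcc_of_collapse (fun v ↦ if k ≤ v then v else k) (by omega) hkb le_rfl
      (by grind) fun u v huv hlt ↦ ?_
    have := hcut u v huv hlt
    have := h.bounds huv
    grind
  · ext x y
    rw [glue_adj (haj.trans_lt hjk)]
    constructor
    · rintro (h' | h' | h' | ⟨rfl, rfl⟩ | ⟨rfl, rfl⟩)
      exacts [h'.1, h'.1, h'.1, hk, hk.symm]
    · intro hxy
      have hb := h.bounds hxy
      simp only [restrictIcc, hxy, true_and]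
      rcases lt_or_gt_of_ne hxy.ne with hlt | hlt
      · have := hcut x y hxy hlt
        omega
      · have := hcut y x hxy.symm hlt
        omega

end NCTreeOn

/-- The noncrossing trees on the vertex set `[a, b]`. -/
noncomputable def ncTrees (a b : ℕ) : Finset (SimpleGraph ℕ) :=
  (NCTreeOn.finite_setOf a b).toFinset

theorem mem_ncTrees {a b : ℕ} {G : SimpleGraph ℕ} : G ∈ ncTrees a b ↔ NCTreeOn a b G := by
  simp [ncTrees]

theorem card_ncTrees_self (a : ℕ) : (ncTrees a a).card = 1 := by
  rw [Finset.card_eq_one]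
  exact ⟨⊥, by ext G; rw [mem_ncTrees, NCTreeOn.self_iff, Finset.mem_singleton]⟩

open Finset.HasAntidiagonal in
theorem card_ncTrees_succ (a m : ℕ) :
    (ncTrees a (a + (m + 1))).card = ∑ p ∈ antidiagonal m, ∑ q ∈ antidiagonal p.1,
      (ncTrees a (a + q.1)).card * ((ncTrees (a + q.1 + 1) (a + q.1 + 1 + q.2)).card *
        (ncTrees (a + p.1 + 1) (a + p.1 + 1 + p.2)).card) := by
  simp_rw [← Finset.card_product, ← Finset.card_sigma]
  symm
  have hsplit {x : (_ : ℕ × ℕ) × (_ : ℕ × ℕ) × SimpleGraph ℕ × SimpleGraph ℕ × SimpleGraph ℕ}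
      (hx : x ∈ (antidiagonal m).sigma fun p ↦ (antidiagonal p.1).sigma fun q ↦
        ncTrees a (a + q.1) ×ˢ ncTrees (a + q.1 + 1) (a + q.1 + 1 + q.2) ×ˢ
          ncTrees (a + p.1 + 1) (a + p.1 + 1 + p.2)) :
      (x.1.1 + x.1.2 = m ∧ x.2.1.1 + x.2.1.2 = x.1.1) ∧
      IsSplit a (a + x.2.1.1) (a + x.1.1 + 1) (a + (m + 1)) x.2.2.1 x.2.2.2.1 x.2.2.2.2 := by
    obtain ⟨⟨p₁, p₂⟩, ⟨q₁, q₂⟩, G₁, G₂, G₃⟩ := x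
    simp only [Finset.mem_sigma, mem_antidiagonal, Finset.mem_product, mem_ncTrees] at hx ⊢
    obtain ⟨rfl, rfl, h₁, h₂, h₃⟩ := hx
    refine ⟨⟨rfl, rfl⟩, by omega, by omega, by omega, h₁, ?_, ?_⟩
    · convert h₂ using 1; omega
    · convert h₃ using 1; omega
  refine Finset.card_nbij (fun x ↦ glue a (a + x.1.1 + 1) x.2.2.1 x.2.2.2.1 x.2.2.2.2)
    (fun x hx ↦ mem_ncTrees.2 (hsplit hx).2.ncTreeOn_glue) (fun x hx y hy hxy ↦ ?_)
    (fun G hG ↦ ?_)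
  · obtain ⟨ex, hx⟩ := hsplit hx
    obtain ⟨ey, hy⟩ := hsplit hy
    have := hx.glue_inj hy hxy
    obtain ⟨⟨p₁, p₂⟩, ⟨q₁, q₂⟩, G₁, G₂, G₃⟩ := x
    obtain ⟨⟨p₁', p₂'⟩, ⟨q₁', q₂'⟩, G₁', G₂', G₃'⟩ := y
    simp only at this ex ey
    obtain ⟨e₁, e₂, rfl, rfl, rfl⟩ := this
    obtain rfl : p₁ = p₁' := by omega
    obtain rfl : p₂ = p₂' := by omega
    obtain rfl : q₁ = q₁' := by omega
    obtain rfl : q₂ = q₂' := by omega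
    rfl
  · obtain ⟨j, k, G₁, G₂, G₃, hs, rfl⟩ := (mem_ncTrees.1 hG).exists_isSplit (by omega)
    have h1 := hs.le
    have h2 := hs.lt
    have h3 := hs.le'
    obtain ⟨q₁, rfl⟩ := Nat.exists_eq_add_of_le h1
    obtain ⟨q₂, rfl⟩ := Nat.exists_eq_add_of_le (Nat.succ_le_of_lt h2)
    obtain ⟨p₂, hp₂⟩ := Nat.exists_eq_add_of_le h3
    refine ⟨⟨(q₁ + q₂, p₂), (q₁, q₂), G₁, G₂, G₃⟩, ?_, ?_⟩
    · simp only [Finset.mem_coe, Finset.mem_sigma, mem_antidiagonal, Finset.mem_product,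
        mem_ncTrees]
      refine ⟨by omega, trivial, hs.fst, hs.snd, ?_⟩
      convert hs.trd using 1 <;> omega
    · simp only
      congr 1
      omega

theorem card_ncTrees_translate (m : ℕ) :
    ∀ a, (ncTrees a (a + m)).card = (ncTrees 0 m).card := by
  induction m using Nat.strong_induction_on with
  | _ m ih =>
    intro a
    rcases m with _ | m
    · simp [card_ncTrees_self]
    · have h0 := card_ncTrees_succ 0 m
      rw [zero_add] at h0
      rw [card_ncTrees_succ, h0]
      refine Finset.sum_congr rfl fun p hp ↦ Finset.sum_congr rfl fun q hq ↦ ?_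
      rw [Finset.HasAntidiagonal.mem_antidiagonal] at hp hq
      rw [ih q.1 (by omega), ih q.1 (by omega), ih q.2 (by omega), ih q.2 (by omega),
        ih p.2 (by omega), ih p.2 (by omega)]

open Finset.HasAntidiagonal in
theorem card_ncTrees_recurrence (m : ℕ) :
    (ncTrees 0 (m + 1)).card = ∑ p ∈ antidiagonal m,
      (∑ q ∈ antidiagonal p.1, (ncTrees 0 q.1).card * (ncTrees 0 q.2).card) *
        (ncTrees 0 p.2).card := by
  have h0 := card_ncTrees_succ 0 m
  rw [zero_add] at h0
  rw [h0]
  refine Finset.sum_congr rfl fun p _ ↦ ?_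
  rw [Finset.sum_mul]
  refine Finset.sum_congr rfl fun q _ ↦ ?_
  simp only [card_ncTrees_translate, mul_assoc]

theorem isNCTree_comap {m : ℕ} {G : SimpleGraph ℕ} (h : NCTreeOn 0 m G) :
    IsNCTree (n := m + 1) (G.comap (Fin.valEmbedding : Fin (m + 1) ↪ ℕ)) := by
  refine ⟨⟨?_, h.acyclic.of_comap _⟩, fun x y u v hxy huv ↦ h.noncrossing hxy huv⟩
  refine @Connected.mk _ _ (fun (x y : Fin (m + 1)) ↦ ?_) ⟨0⟩
  have hxy := (h.reachable (Nat.zero_le _) (Nat.le_of_lt_succ x.isLt)).symm.trans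
    (h.reachable (Nat.zero_le _) (Nat.le_of_lt_succ y.isLt))
  have key := hxy.of_collapse (H := G.comap (Fin.valEmbedding : Fin (m + 1) ↪ ℕ))
    (Fin.ofNat (m + 1)) fun u v huv ↦ .inr ?_
  · rwa [Fin.ofNat_eq_cast, Fin.ofNat_eq_cast, Fin.cast_val_eq_self, Fin.cast_val_eq_self] at key
  · have hb := h.bounds huv
    simpa [Nat.mod_eq_of_lt (show u < m + 1 by omega),
      Nat.mod_eq_of_lt (show v < m + 1 by omega)] using huv

theorem ncTreeOn_map {m : ℕ} {G : SimpleGraph (Fin (m + 1))} (h : IsNCTree (n := m + 1) G) :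
    NCTreeOn 0 m (G.map Fin.valEmbedding) := by
  have hb {x y : ℕ} (hxy : (G.map Fin.valEmbedding).Adj x y) : x ≤ m := by
    obtain ⟨_, u, v, _, rfl, _⟩ := hxy
    exact Nat.le_of_lt_succ u.isLt
  refine ⟨fun _ ↦ Nat.zero_le _, hb, fun {x} _ hx ↦ ?_, ?_, ?_⟩
  · have := (h.1.connected.preconnected (0 : Fin (m + 1)) ⟨x, Nat.lt_succ_of_le hx⟩).map
      (Embedding.map Fin.valEmbedding G).toHom
    simpa using this
  · have hG : G.IsAcyclic := h.1.isAcyclic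
    rw [isAcyclic_iff_forall_adj_isBridge] at hG ⊢
    rintro _ _ ⟨_, x, y, hxy, rfl, rfl⟩
    refine IsBridge.of_collapse (H := G) (Fin.ofNat (m + 1)) ?_
      (by simpa using hG hxy)
    rintro _ _ ⟨_, u, v, huv, rfl, rfl⟩
    right
    simpa [Fin.val_inj] using huv
  · rintro _ _ _ _ ⟨_, x, y, hxy, rfl, rfl⟩ ⟨_, u, v, huv, rfl, rfl⟩
    exact h.2 x y u v hxy huv

theorem A_succ (m : ℕ) : A (m + 1) = (ncTrees 0 m).card := by
  have e : {G : SimpleGraph (Fin (m + 1)) // IsNCTree (n := m + 1) G} ≃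
      {G : SimpleGraph ℕ // G ∈ ncTrees 0 m} :=
    { toFun G := ⟨G.1.map Fin.valEmbedding, mem_ncTrees.2 (ncTreeOn_map G.2)⟩
      invFun G := ⟨G.1.comap Fin.valEmbedding, isNCTree_comap (mem_ncTrees.1 G.2)⟩
      left_inv G := Subtype.ext (comap_map_eq _ _)
      right_inv G := by
        refine Subtype.ext ?_
        ext x y
        constructor
        · rintro ⟨_, u, v, huv, rfl, rfl⟩
          exact huv
        · intro hxy
          have hb := (mem_ncTrees.1 G.2).bounds hxy
          exact ⟨hxy.ne, ⟨x, by omega⟩, ⟨y, by omega⟩, hxy, rfl, rfl⟩ }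
  exact (Nat.card_congr e).trans (Nat.card_eq_card_toFinset _ |>.trans (by simp))

theorem A_closed_form :
    ∀ n : ℕ, 1 ≤ n → (2 * n - 1) * A n = Nat.choose (3 * n - 3) (n - 1) := by
  intro n hn
  obtain ⟨m, rfl⟩ := Nat.exists_eq_add_of_le' hn
  rw [A_succ, show 2 * (m + 1) - 1 = 2 * m + 1 by omega, show 3 * (m + 1) - 3 = 3 * m by omega,
    Nat.add_sub_cancel]
  exact TernarySeries.coeff_closed_form (t := fun m ↦ (ncTrees 0 m).card)
    (card_ncTrees_self 0) card_ncTrees_recurrence m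
end

section
/- For every integer n ≥ 2, the number A_1(n) of n-noncrossing trees in which vertex 1 has degree 1 equals (2/(3n−4))·binom(3n−4, n−2); equivalently, (3n−4)·A_1(n) = 2·binom(3n−4, n−2). Moreover A_1(1) = 0. -/
namespace SimpleGraph

variable {V W : Type*}

theorem Reachable.of_forall_adj {G : SimpleGraph V} {H : SimpleGraph W} {u v : V} (f : V → W)
    (hf : ∀ x y, G.Adj x y → f x = f y ∨ H.Adj (f x) (f y)) (h : G.Reachable u v) :
    H.Reachable (f u) (f v) := by
  rw [reachable_iff_reflTransGen] at h
  induction h with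
  | refl => rfl
  | tail _ h ih =>
    rcases hf _ _ h with h | h
    · exact h ▸ ih
    · exact ih.trans h.reachable

theorem Reachable.exists_adj_of_not {G : SimpleGraph V} {u v : V} (h : G.Reachable u v)
    (P : V → Prop) (hu : P u) (hv : ¬ P v) :
    ∃ x y, G.Adj x y ∧ G.Reachable u x ∧ P x ∧ ¬ P y := by
  rw [reachable_iff_reflTransGen] at h
  induction h with
  | refl => exact absurd hu hv
  | @tail y z h' h ih =>
    by_cases hy : P y
    · exact ⟨y, z, h, (reachable_iff_reflTransGen _ _).2 h', hy, hv⟩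
    · exact ih hy

/-- A graph is acyclic if each of its edges survives some map to an acyclic graph that
contracts or preserves edges and identifies that edge with no other. -/
theorem isAcyclic_of_forall_adj {G : SimpleGraph V}
    (h : ∀ x y, G.Adj x y → ∃ (H : SimpleGraph W) (f : V → W), H.IsAcyclic ∧ H.Adj (f x) (f y) ∧
      ∀ u v, G.Adj u v → f u = f v ∨
        H.Adj (f u) (f v) ∧ (s(f u, f v) = s(f x, f y) → s(u, v) = s(x, y))) :
    G.IsAcyclic := by
  rw [isAcyclic_iff_forall_adj_isBridge]
  intro x y hxy
  obtain ⟨H, f, hH, hadj, hf⟩ := h x y hxy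
  rw [isBridge_iff]
  intro hr
  refine isBridge_iff.1 (isAcyclic_iff_forall_adj_isBridge.1 hH hadj) (hr.of_forall_adj f ?_)
  intro u v huv
  rw [deleteEdges_adj] at huv ⊢
  rcases hf u v huv.1 with h | ⟨h, h'⟩
  · exact Or.inl h
  · exact Or.inr ⟨h, fun he => huv.2 (h' he)⟩

/-- The edges of `G` with both endpoints in the interval `[a, b]`. -/
def onInterval (G : SimpleGraph ℕ) (a b : ℕ) : SimpleGraph ℕ where
  Adj x y := G.Adj x y ∧ (a ≤ x ∧ x ≤ b) ∧ a ≤ y ∧ y ≤ b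
  symm := ⟨fun _ _ h => ⟨h.1.symm, h.2.2, h.2.1⟩⟩
  loopless := ⟨fun _ h => h.1.ne rfl⟩

theorem onInterval_adj {G : SimpleGraph ℕ} {a b x y : ℕ} :
    (G.onInterval a b).Adj x y ↔ G.Adj x y ∧ (a ≤ x ∧ x ≤ b) ∧ a ≤ y ∧ y ≤ b := Iff.rfl

theorem onInterval_le (G : SimpleGraph ℕ) (a b : ℕ) : G.onInterval a b ≤ G := fun _ _ h => h.1

/-- `G` is a noncrossing tree on the interval `[a, b]`, the vertices outside being isolated. -/
structure IsNCTreeOn (a b : ℕ) (G : SimpleGraph ℕ) : Prop where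
  supp : ∀ x y, G.Adj x y → a ≤ x ∧ x ≤ b
  conn : ∀ x, a ≤ x → x ≤ b → G.Reachable a x
  acyclic : G.IsAcyclic
  noncrossing : ∀ w x y z, G.Adj w x → G.Adj y z → ¬ (w < y ∧ y < x ∧ x < z)

namespace IsNCTreeOn

variable {a b k l : ℕ} {G G₁ G₂ : SimpleGraph ℕ}

theorem supp' (h : IsNCTreeOn a b G) {x y : ℕ} (hxy : G.Adj x y) :
    (a ≤ x ∧ x ≤ b) ∧ (a ≤ y ∧ y ≤ b) ∧ x ≠ y :=
  ⟨h.supp _ _ hxy, h.supp _ _ hxy.symm, hxy.ne⟩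

theorem reachable (h : IsNCTreeOn a b G) {x y : ℕ} (hx : a ≤ x) (hx' : x ≤ b) (hy : a ≤ y)
    (hy' : y ≤ b) : G.Reachable x y :=
  (h.conn x hx hx').symm.trans (h.conn y hy hy')

theorem isAcyclic_sup (h₁ : IsNCTreeOn a k G₁) (h₂ : IsNCTreeOn l b G₂) (hkl : k ≤ l) :
    (G₁ ⊔ G₂).IsAcyclic := by
  refine isAcyclic_of_forall_adj (W := ℕ) fun x y hxy => ?_
  rcases hxy with hxy | hxy
  · have := h₁.supp' hxy
    refine ⟨G₁, fun i => min i k, h₁.acyclic, by grind, ?_⟩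
    rintro u v (huv | huv)
    · have := h₁.supp' huv
      right
      grind
    · have := h₂.supp' huv
      left
      grind
  · have := h₂.supp' hxy
    refine ⟨G₂, fun i => max i l, h₂.acyclic, by grind, ?_⟩
    rintro u v (huv | huv)
    · have := h₁.supp' huv
      left
      grind
    · have := h₂.supp' huv
      right
      grind

theorem noncrossing_sup (h₁ : IsNCTreeOn a k G₁) (h₂ : IsNCTreeOn l b G₂) (hkl : k ≤ l)
    (w x y z : ℕ) (hwx : (G₁ ⊔ G₂).Adj w x) (hyz : (G₁ ⊔ G₂).Adj y z) :
    ¬ (w < y ∧ y < x ∧ x < z) := by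
  rcases hwx with hwx | hwx <;> rcases hyz with hyz | hyz
  · exact h₁.noncrossing _ _ _ _ hwx hyz
  · have := h₁.supp' hwx
    have := h₂.supp' hyz
    omega
  · have := h₂.supp' hwx
    have := h₁.supp' hyz
    omega
  · exact h₂.noncrossing _ _ _ _ hwx hyz

/-- Gluing two trees at a common vertex. -/
theorem sup (h₁ : IsNCTreeOn a k G₁) (h₂ : IsNCTreeOn k b G₂) (hak : a ≤ k) (hkb : k ≤ b) :
    IsNCTreeOn a b (G₁ ⊔ G₂) where
  supp x y hxy := by
    rcases hxy with hxy | hxy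
    · have := h₁.supp' hxy
      omega
    · have := h₂.supp' hxy
      omega
  conn x hx hx' := by
    rcases le_total x k with h | h
    · exact (h₁.conn x hx h).mono le_sup_left
    · exact ((h₁.conn k hak le_rfl).mono le_sup_left).trans ((h₂.conn x h hx').mono le_sup_right)
  acyclic := h₁.isAcyclic_sup h₂ le_rfl
  noncrossing := h₁.noncrossing_sup h₂ le_rfl

theorem onInterval_of_reachable (h : IsNCTreeOn a b G)
    (hc : ∀ x, k ≤ x → x ≤ l → (G.onInterval k l).Reachable k x) :
    IsNCTreeOn k l (G.onInterval k l) where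
  supp _ _ hxy := hxy.2.1
  conn := hc
  acyclic := h.acyclic.anti (onInterval_le _ _ _)
  noncrossing _ _ _ _ h₁ h₂ := h.noncrossing _ _ _ _ h₁.1 h₂.1

theorem onInterval_left (h : IsNCTreeOn a b G) (hkb : k ≤ b)
    (hk : ∀ x y, G.Adj x y → ¬ (x < k ∧ k < y)) : IsNCTreeOn a k (G.onInterval a k) := by
  refine h.onInterval_of_reachable fun x hx hx' => ?_
  have := (h.conn x hx (hx'.trans hkb)).of_forall_adj (H := G.onInterval a k) (fun i => min i k) ?_
  · simpa [hx', hx.trans hx'] using this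
  · intro u v huv
    have := h.supp' huv
    have := hk _ _ huv
    have := hk _ _ huv.symm
    simp only [onInterval_adj]
    grind

theorem onInterval_right (h : IsNCTreeOn a b G) (hak : a ≤ k)
    (hk : ∀ x y, G.Adj x y → ¬ (x < k ∧ k < y)) : IsNCTreeOn k b (G.onInterval k b) := by
  refine h.onInterval_of_reachable fun x hx hx' => ?_
  have := (h.reachable hak (hx.trans hx') (hak.trans hx) hx').of_forall_adj
    (H := G.onInterval k b) (fun i => max i k) ?_
  · simpa [hx] using this
  · intro u v huv
    have := h.supp' huv
    have := hk _ _ huv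
    have := hk _ _ huv.symm
    simp only [onInterval_adj]
    grind

theorem onInterval_sup_onInterval (h : IsNCTreeOn a b G)
    (hk : ∀ x y, G.Adj x y → ¬ (x < k ∧ k < y)) :
    G.onInterval a k ⊔ G.onInterval k b = G := by
  ext x y
  simp only [sup_adj, onInterval_adj]
  constructor
  · rintro (h | h) <;> exact h.1
  · intro hxy
    have := h.supp' hxy
    have := hk _ _ hxy
    have := hk _ _ hxy.symm
    grind

/-- Joining trees on consecutive intervals by the edge between the extreme vertices. -/
theorem sup_edge (h₁ : IsNCTreeOn a k G₁) (h₂ : IsNCTreeOn (k + 1) b G₂) (hak : a ≤ k)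
    (hkb : k + 1 ≤ b) : IsNCTreeOn a b (G₁ ⊔ G₂ ⊔ edge a b) where
  supp x y hxy := by
    rcases hxy with (hxy | hxy) | hxy
    · have := h₁.supp' hxy
      omega
    · have := h₂.supp' hxy
      omega
    · rw [edge_adj] at hxy
      omega
  conn x hx hx' := by
    rcases Nat.lt_or_ge k x with h | h
    · have : (G₁ ⊔ G₂ ⊔ edge a b).Adj a b := by
        rw [sup_adj, edge_adj]
        grind
      exact this.reachable.trans ((h₂.reachable hkb le_rfl h hx').mono
        (le_sup_right.trans le_sup_left))
    · exact (h₁.conn x hx h).mono (le_sup_left.trans le_sup_left)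
  acyclic := by
    refine (h₁.isAcyclic_sup h₂ k.le_succ).sup_edge_of_not_reachable fun h => ?_
    obtain ⟨x, y, hxy, -, hx, hy⟩ := h.exists_adj_of_not (· ≤ k) hak (by omega)
    rcases hxy with hxy | hxy
    · have := h₁.supp' hxy
      omega
    · have := h₂.supp' hxy
      omega
  noncrossing w x y z hwx hyz := by
    have hs : ∀ u v, (G₁ ⊔ G₂).Adj u v → (a ≤ u ∧ u ≤ b) ∧ (a ≤ v ∧ v ≤ b) := by
      rintro u v (huv | huv)
      · have := h₁.supp' huv
        omega
      · have := h₂.supp' huv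
        omega
    rcases hwx with hwx | hwx <;> rcases hyz with hyz | hyz
    · exact h₁.noncrossing_sup h₂ k.le_succ _ _ _ _ hwx hyz
    · have := hs _ _ hwx
      rw [edge_adj] at hyz
      omega
    · have := hs _ _ hyz
      rw [edge_adj] at hwx
      omega
    · rw [edge_adj] at hwx hyz
      omega

/-- Attaching a new first vertex as a leaf. -/
theorem sup_edge_leaf (h₁ : IsNCTreeOn (a + 1) k G₁) (h₂ : IsNCTreeOn k b G₂) (hak : a + 1 ≤ k)
    (hkb : k ≤ b) : IsNCTreeOn a b (G₁ ⊔ G₂ ⊔ edge a k) := by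
  have h := h₁.sup h₂ hak hkb
  have hak' : (G₁ ⊔ G₂ ⊔ edge a k).Adj a k := by
    rw [sup_adj, edge_adj]
    grind
  refine ⟨fun x y hxy => ?_, fun x hx hx' => ?_, ?_, fun w x y z hwx hyz => ?_⟩
  · rcases hxy with hxy | hxy
    · have := h.supp' hxy
      omega
    · rw [edge_adj] at hxy
      omega
  · rcases hx.eq_or_lt with rfl | hx
    · rfl
    · exact hak'.reachable.trans ((h.reachable hak hkb hx hx').mono le_sup_left)
  · refine h.acyclic.sup_edge_of_not_reachable fun hr => ?_
    obtain ⟨x, y, hxy, -, hx, hy⟩ := hr.exists_adj_of_not (· ≤ a) le_rfl (by omega)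
    have := h.supp' hxy
    omega
  · have hs : ∀ u v, (G₁ ⊔ G₂).Adj u v → a < u ∧ a < v ∧ (u ≤ k ∧ v ≤ k ∨ k ≤ u ∧ k ≤ v) := by
      rintro u v (huv | huv)
      · have := h₁.supp' huv
        omega
      · have := h₂.supp' huv
        omega
    rcases hwx with hwx | hwx <;> rcases hyz with hyz | hyz
    · exact h.noncrossing _ _ _ _ hwx hyz
    · have := hs _ _ hwx
      rw [edge_adj] at hyz
      omega
    · have := hs _ _ hyz
      rw [edge_adj] at hwx
      omega
    · rw [edge_adj] at hwx hyz
      omega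

/-- A tree containing the edge between the extreme vertices decomposes uniquely. -/
theorem exists_eq_sup_edge (h : IsNCTreeOn a b G) (hab : G.Adj a b) (hlt : a < b) :
    ∃ k, a ≤ k ∧ k < b ∧ IsNCTreeOn a k (G.onInterval a k) ∧
      IsNCTreeOn (k + 1) b (G.onInterval (k + 1) b) ∧
      G.onInterval a k ⊔ G.onInterval (k + 1) b ⊔ edge a b = G := by
  set H := G.deleteEdges {s(a, b)} with hH
  have hHG : ∀ {x y}, H.Adj x y → G.Adj x y := fun hxy => (G.deleteEdges_le _) hxy
  have hGH : ∀ {x y}, G.Adj x y → H.Adj x y ∨ (x = a ∧ y = b) ∨ (x = b ∧ y = a) := by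
    intro x y hxy
    simp only [hH, deleteEdges_adj, Set.mem_singleton_iff, Sym2.eq_iff]
    tauto
  have hHab : ¬ H.Reachable a b :=
    isBridge_iff.1 (isAcyclic_iff_forall_adj_isBridge.1 h.acyclic hab)
  have hcov : ∀ x, a ≤ x → x ≤ b → ¬ H.Reachable a x → H.Reachable x b := by
    intro x hx hx' hax
    obtain ⟨u, v, huv, -, hu, hv⟩ :=
      (h.conn x hx hx').exists_adj_of_not (fun i => ¬ H.Reachable i x) hax (by simp)
    rw [not_not] at hv
    rcases hGH huv with h' | ⟨rfl, rfl⟩ | ⟨rfl, rfl⟩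
    · exact absurd (h'.reachable.trans hv) hu
    · exact hv.symm
    · exact absurd hv hax
  have hdown : ∀ x y, a ≤ x → x < y → y ≤ b → H.Reachable a y → H.Reachable a x := by
    intro x y hx hxy hy hay
    by_contra hax
    have hxa : x ≠ a := by
      rintro rfl
      exact hax .rfl
    obtain ⟨u, v, huv, hau, hux, hvx⟩ := hay.exists_adj_of_not (· < x) (by omega) (by omega)
    have hav := hau.trans huv.reachable
    have hxb := hcov x hx (by omega) hax
    have hvx' : v ≠ x := by
      rintro rfl
      exact hax hav
    have := h.supp' (hHG huv)
    obtain ⟨c, d, hcd, hxc, hc, hd⟩ :=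
      hxb.exists_adj_of_not (fun i => u < i ∧ i < v) (by omega) (by omega)
    have hac : ¬ H.Reachable a c := fun hac => hax (hac.trans hxc.symm)
    have hdu : d ≠ u := by
      rintro rfl
      exact hac (hau.trans hcd.symm.reachable)
    have hdv : d ≠ v := by
      rintro rfl
      exact hac (hav.trans hcd.symm.reachable)
    have := h.noncrossing _ _ _ _ (hHG huv) (hHG hcd)
    have := h.noncrossing _ _ _ _ (hHG hcd).symm (hHG huv)
    omega
  classical
  set k := Nat.findGreatest (fun i => a ≤ i ∧ H.Reachable a i) b with hk
  have hkP : a ≤ k ∧ H.Reachable a k :=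
    Nat.findGreatest_spec (P := fun i => a ≤ i ∧ H.Reachable a i) hlt.le ⟨le_rfl, .rfl⟩
  have hkb : k < b := by
    refine (Nat.findGreatest_le b).lt_of_ne fun h => hHab ?_
    have := hkP.2
    rwa [hk, h] at this
  have hiff : ∀ x, a ≤ x → x ≤ b → (H.Reachable a x ↔ x ≤ k) := by
    refine fun x hx hx' => ⟨fun hax => Nat.le_findGreatest hx' ⟨hx, hax⟩, fun hxk => ?_⟩
    rcases hxk.eq_or_lt with rfl | hxk
    · exact hkP.2
    · exact hdown x k hx hxk hkb.le hkP.2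
  have hside : ∀ {x y}, H.Adj x y → (x ≤ k ↔ y ≤ k) := by
    intro x y hxy
    have := h.supp' (hHG hxy)
    rw [← hiff x (by omega) (by omega), ← hiff y (by omega) (by omega)]
    exact ⟨fun h => h.trans hxy.reachable, fun h => h.trans hxy.symm.reachable⟩
  refine ⟨k, hkP.1, hkb, h.onInterval_of_reachable fun x hx hx' => ?_,
    h.onInterval_of_reachable fun x hx hx' => ?_, ?_⟩
  · have := ((hiff x hx (by omega)).2 hx').of_forall_adj (H := G.onInterval a k)
      (fun i => min i k) ?_
    · simpa [hx', hkP.1] using this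
    · intro u v huv
      have := h.supp' (hHG huv)
      have := hside huv
      have := hHG huv
      simp only [onInterval_adj]
      grind
  · have hr : ∀ y, k + 1 ≤ y → y ≤ b → H.Reachable y b := by
      intro y hy hy'
      refine hcov y (by omega) hy' fun hay => ?_
      have := (hiff y (by omega) hy').1 hay
      omega
    have := ((hr (k + 1) le_rfl hkb).trans (hr x hx hx').symm).of_forall_adj
      (H := G.onInterval (k + 1) b) (fun i => max i (k + 1)) ?_
    · simpa [hx] using this
    · intro u v huv
      have := h.supp' (hHG huv)
      have := hside huv
      have := hHG huv
      simp only [onInterval_adj]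
      grind
  · ext x y
    simp only [sup_adj, onInterval_adj, edge_adj]
    constructor
    · rintro ((h | h) | ⟨⟨rfl, rfl⟩ | ⟨rfl, rfl⟩, -⟩)
      · exact h.1
      · exact h.1
      · exact hab
      · exact hab.symm
    · intro hxy
      have := h.supp' hxy
      rcases hGH hxy with h' | h' | h'
      · have := hside h'
        by_cases x ≤ k
        · left; left; exact ⟨hxy, by omega, by omega⟩
        · left; right; exact ⟨hxy, by omega, by omega⟩
      · exact Or.inr ⟨Or.inl h', hxy.ne⟩
      · exact Or.inr ⟨Or.inr h', hxy.ne⟩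

theorem exists_adj (h : IsNCTreeOn a b G) (hab : a < b) : ∃ y, G.Adj a y := by
  obtain ⟨x, y, hxy, -, rfl, -⟩ :=
    (h.conn b hab.le le_rfl).exists_adj_of_not (· = a) rfl hab.ne'
  exact ⟨y, hxy⟩

/-- The last neighbour of the first vertex is not covered by any edge. -/
theorem exists_adj_not_covered (h : IsNCTreeOn a b G) (hab : a < b) :
    ∃ k, a < k ∧ k ≤ b ∧ G.Adj a k ∧ ∀ x y, G.Adj x y → ¬ (x < k ∧ k < y) := by
  classical
  obtain ⟨y, hy⟩ := h.exists_adj hab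
  have hk : G.Adj a (Nat.findGreatest (G.Adj a) b) :=
    Nat.findGreatest_spec (h.supp' hy).2.1.2 hy
  have := h.supp' hk
  refine ⟨_, by omega, by omega, hk, fun u v huv huv' => ?_⟩
  have := h.supp' huv
  rcases this.1.1.eq_or_lt with rfl | hu
  · have := Nat.le_findGreatest this.2.1.2 huv
    omega
  · exact h.noncrossing _ _ _ _ hk huv ⟨hu, huv'⟩

theorem exists_eq_sup_edge_leaf (h : IsNCTreeOn a b G) (hak : G.neighborSet a = {k}) :
    a < k ∧ k ≤ b ∧ IsNCTreeOn (a + 1) k (G.onInterval (a + 1) k) ∧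
      IsNCTreeOn k b (G.onInterval k b) ∧
      G.onInterval (a + 1) k ⊔ G.onInterval k b ⊔ edge a k = G := by
  have hadj : ∀ y, G.Adj a y ↔ y = k := fun y => by
    rw [← mem_neighborSet, hak, Set.mem_singleton_iff]
  have hk : G.Adj a k := (hadj k).2 rfl
  have hs := h.supp' hk
  have h' : IsNCTreeOn (a + 1) b (G.onInterval (a + 1) b) := by
    refine h.onInterval_of_reachable fun x hx hx' => ?_
    have := (h.reachable (x := a + 1) (y := x) (by omega) (by omega) (by omega) hx').of_forall_adj
      (H := G.onInterval (a + 1) b) (fun i => if i = a then k else i) ?_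
    · simpa [show x ≠ a by omega] using this
    · intro u v huv
      have := h.supp' huv
      have := hadj u
      have := hadj v
      have := huv.symm
      simp only [onInterval_adj]
      grind
  have hcov : ∀ x y, (G.onInterval (a + 1) b).Adj x y → ¬ (x < k ∧ k < y) := by
    intro x y hxy hxky
    exact h.noncrossing _ _ _ _ hk hxy.1 ⟨hxy.2.1.1, hxky⟩
  have hl : (G.onInterval (a + 1) b).onInterval (a + 1) k = G.onInterval (a + 1) k := by
    ext x y
    simp only [onInterval_adj]
    grind
  have hr : (G.onInterval (a + 1) b).onInterval k b = G.onInterval k b := by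
    ext x y
    simp only [onInterval_adj]
    grind
  refine ⟨by omega, by omega, hl ▸ h'.onInterval_left (by omega) hcov,
    hr ▸ h'.onInterval_right (by omega) hcov, ?_⟩
  have := h'.onInterval_sup_onInterval hcov
  rw [hl, hr] at this
  rw [this]
  ext x y
  simp only [sup_adj, onInterval_adj, edge_adj]
  constructor
  · rintro (h | ⟨⟨rfl, rfl⟩ | ⟨rfl, rfl⟩, -⟩)
    · exact h.1
    · exact hk
    · exact hk.symm
  · intro hxy
    have := h.supp' hxy
    have := hadj x
    have := hadj y
    have := hxy.symm
    grind

end IsNCTreeOn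

theorem finite_setOf_isNCTreeOn (a b : ℕ) : {G | IsNCTreeOn a b G}.Finite := by
  have : Set.InjOn (SimpleGraph.comap ((↑) : Set.Icc a b → ℕ)) {G | IsNCTreeOn a b G} := by
    intro G hG H hH h
    ext x y
    have := fun hx hy => congrArg (fun K : SimpleGraph (Set.Icc a b) => K.Adj ⟨x, hx⟩ ⟨y, hy⟩) h
    simp only [comap_adj, Set.mem_Icc, eq_iff_iff] at this
    exact ⟨fun hxy => (this (hG.supp' hxy).1 (hG.supp' hxy).2.1).1 hxy,
      fun hxy => (this (hH.supp' hxy).1 (hH.supp' hxy).2.1).2 hxy⟩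
  exact Set.Finite.of_finite_image (Set.toFinite _) this

/-- Relabelling the vertices of an interval by `ZMod (m + 1)`. -/
theorem bijOn_comap_isNCTreeOn (a m : ℕ) :
    Set.BijOn (fun G : SimpleGraph ℕ => G.comap fun i : ZMod (m + 1) => a + i.val)
      {G | IsNCTreeOn a (a + m) G} {G | IsNCTree G} := by
  have hlt : ∀ i : ZMod (m + 1), i.val ≤ m := fun i => Nat.le_of_lt_succ i.val_lt
  have hinj : ∀ i j : ZMod (m + 1), i.val = j.val → i = j := fun i j h => ZMod.val_injective _ h
  have hval : ∀ x, a ≤ x → x ≤ a + m → a + ((x - a : ℕ) : ZMod (m + 1)).val = x := by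
    intro x hx hx'
    rw [ZMod.val_cast_of_lt (by omega)]
    omega
  have hcast : ∀ i : ZMod (m + 1), ((a + i.val - a : ℕ) : ZMod (m + 1)) = i := by simp
  refine ⟨fun G hG => ⟨⟨⟨fun i j => ?_⟩, ?_⟩, ?_⟩, fun G hG H hH h => ?_, fun G hG => ?_⟩
  · have := (hG.reachable (x := a + i.val) (y := a + j.val) (by omega) (by grind) (by omega)
      (by grind)).of_forall_adj (H := G.comap fun i : ZMod (m + 1) => a + i.val)
      (fun x => ((x - a : ℕ) : ZMod (m + 1))) ?_
    · simpa using this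
    · intro u v huv
      have hs := hG.supp' huv
      right
      simpa only [comap_adj, hval u hs.1.1 hs.1.2, hval v hs.2.1.1 hs.2.1.2] using huv
  · exact hG.acyclic.of_comap ⟨fun i : ZMod (m + 1) => a + i.val, fun i j hij => by
      exact hinj i j (by simpa using hij)⟩
  · intro w x y z hwx hyz
    simpa using hG.noncrossing _ _ _ _ hwx hyz
  · ext x y
    have := fun i j : ZMod (m + 1) =>
      congrArg (fun K : SimpleGraph (ZMod (m + 1)) => K.Adj i j) h
    simp only [comap_adj, eq_iff_iff] at this
    constructor
    · intro hxy
      have hs := hG.supp' hxy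
      have := this (x - a : ℕ) (y - a : ℕ)
      rw [hval x hs.1.1 hs.1.2, hval y hs.2.1.1 hs.2.1.2] at this
      exact this.1 hxy
    · intro hxy
      have hs := hH.supp' hxy
      have := this (x - a : ℕ) (y - a : ℕ)
      rw [hval x hs.1.1 hs.1.2, hval y hs.2.1.1 hs.2.1.2] at this
      exact this.2 hxy
  · let H : SimpleGraph ℕ :=
      { Adj x y := (a ≤ x ∧ x ≤ a + m) ∧ (a ≤ y ∧ y ≤ a + m) ∧
          G.Adj (x - a : ℕ) (y - a : ℕ)
        symm := ⟨fun _ _ h => ⟨h.2.1, h.1, h.2.2.symm⟩⟩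
        loopless := ⟨fun _ h => h.2.2.ne rfl⟩ }
    refine ⟨H, ⟨fun x y h => h.1, fun x hx hx' => ?_, ?_, ?_⟩, ?_⟩
    · have := (hG.1.connected.preconnected ((a - a : ℕ) : ZMod (m + 1))
        ((x - a : ℕ) : ZMod (m + 1))).of_forall_adj (H := H) (fun i => a + i.val) ?_
      · rwa [hval a le_rfl (by omega), hval x hx hx'] at this
      · intro u v huv
        right
        exact ⟨by grind, by grind, by rwa [hcast, hcast]⟩
    · refine isAcyclic_of_forall_adj (W := ZMod (m + 1)) fun x y hxy =>
        ⟨G, fun x => ((x - a : ℕ) : ZMod (m + 1)), hG.1.isAcyclic, hxy.2.2, fun u v huv =>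
          Or.inr ⟨huv.2.2, fun h => ?_⟩⟩
      have := congrArg (Sym2.map fun i : ZMod (m + 1) => a + i.val) h
      simpa only [Sym2.map_mk, Prod.map_apply, hval x hxy.1.1 hxy.1.2,
        hval y hxy.2.1.1 hxy.2.1.2, hval u huv.1.1 huv.1.2, hval v huv.2.1.1 huv.2.1.2] using this
    · intro w x y z hwx hyz h
      refine hG.2 _ _ _ _ hwx.2.2 hyz.2.2 ?_
      have := hval w hwx.1.1 hwx.1.2
      have := hval x hwx.2.1.1 hwx.2.1.2
      have := hval y hyz.1.1 hyz.1.2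
      have := hval z hyz.2.1.1 hyz.2.1.2
      omega
    · ext i j
      have := hlt i
      have := hlt j
      simp only [comap_adj, H, hcast]
      grind

theorem ncard_isNCTreeOn (a m : ℕ) : {G | IsNCTreeOn a (a + m) G}.ncard = A (m + 1) := by
  rw [A, ← (bijOn_comap_isNCTreeOn a m).injOn.ncard_image,
    (bijOn_comap_isNCTreeOn a m).image_eq]
  rfl

theorem ncard_isNCTreeOn_leaf (m : ℕ) :
    {G | IsNCTreeOn 0 m G ∧ ∃ k, G.neighborSet 0 = {k}}.ncard = A₁ (m + 1) := by
  have hbij := bijOn_comap_isNCTreeOn 0 m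
  rw [zero_add] at hbij
  have hnbr : ∀ G, IsNCTreeOn 0 m G →
      ((G.comap fun i : ZMod (m + 1) => 0 + i.val).neighborSet 0).ncard =
        (G.neighborSet 0).ncard := by
    intro G hG
    rw [← Set.ncard_image_of_injective _ (ZMod.val_injective (m + 1))]
    congr 1
    ext x
    simp only [zero_add, Set.mem_image, mem_neighborSet, comap_adj, ZMod.val_zero]
    constructor
    · rintro ⟨i, hi, rfl⟩
      exact hi
    · intro hx
      have hxm := (hG.supp' hx).2.1.2
      have : ((x : ℕ) : ZMod (m + 1)).val = x := ZMod.val_cast_of_lt (by omega)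
      exact ⟨x, by rwa [this], this⟩
  rw [A₁, ← (hbij.injOn.mono fun G hG => hG.1).ncard_image]
  change _ = Set.ncard {G : SimpleGraph (ZMod (m + 1)) | _}
  congr 1
  ext G
  simp only [Set.mem_image, Set.mem_ofPred_eq]
  constructor
  · rintro ⟨H, ⟨hH, hk⟩, rfl⟩
    exact ⟨hbij.mapsTo hH, by rw [hnbr H hH, Set.ncard_eq_one]; exact hk⟩
  · rintro ⟨hG, hk⟩
    obtain ⟨H, hH, rfl⟩ := hbij.surjOn hG
    exact ⟨H, ⟨hH, by rw [← Set.ncard_eq_one, ← hnbr H hH]; exact hk⟩, rfl⟩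

theorem ncard_eq_sum_mul {α β γ : Type*} {S : Set γ} (n : ℕ) {T : ℕ → Set α} {U : ℕ → Set β}
    (F : ℕ → α → β → γ) (hT : ∀ k, (T k).Finite) (hU : ∀ k, (U k).Finite)
    (hmem : ∀ k < n, ∀ x ∈ T k, ∀ y ∈ U k, F k x y ∈ S)
    (hne : ∀ k l, k < l → l < n → ∀ x ∈ T k, ∀ y ∈ U k, ∀ x' ∈ T l, ∀ y' ∈ U l,
      F k x y ≠ F l x' y')
    (hinj : ∀ k < n, ∀ x ∈ T k, ∀ y ∈ U k, ∀ x' ∈ T k, ∀ y' ∈ U k,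
      F k x y = F k x' y' → x = x' ∧ y = y')
    (hsurj : ∀ z ∈ S, ∃ k < n, ∃ x ∈ T k, ∃ y ∈ U k, F k x y = z) :
    S.ncard = ∑ k ∈ Finset.range n, (T k).ncard * (U k).ncard := by
  classical
  have hS : S = ↑((Finset.range n).biUnion fun k =>
      ((hT k).toFinset ×ˢ (hU k).toFinset).image fun p => F k p.1 p.2) := by
    ext z
    simp only [Finset.coe_biUnion, Finset.coe_range, Set.mem_iUnion, Finset.mem_coe,
      Finset.mem_image, Finset.mem_product, Set.Finite.mem_toFinset, Prod.exists, Set.mem_Iio]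
    constructor
    · intro hz
      obtain ⟨k, hk, x, hx, y, hy, h⟩ := hsurj z hz
      exact ⟨k, hk, x, y, ⟨hx, hy⟩, h⟩
    · rintro ⟨k, hk, x, y, ⟨hx, hy⟩, rfl⟩
      exact hmem k hk x hx y hy
  rw [hS, Set.ncard_coe_finset, Finset.card_biUnion]
  · refine Finset.sum_congr rfl fun k hk => ?_
    rw [Finset.card_image_of_injOn, Finset.card_product, Set.ncard_eq_toFinset_card _ (hT k),
      Set.ncard_eq_toFinset_card _ (hU k)]
    rintro ⟨x, y⟩ hxy ⟨x', y'⟩ hxy' h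
    simp only [Finset.coe_product, Set.mem_prod, Finset.mem_coe,
      Set.Finite.mem_toFinset] at hxy hxy'
    exact Prod.ext_iff.2
      (hinj k (Finset.mem_range.1 hk) x hxy.1 y hxy.2 x' hxy'.1 y' hxy'.2 h)
  · intro k hk l hl hkl
    rw [Function.onFun, Finset.disjoint_left]
    simp only [Finset.coe_range, Set.mem_Iio] at hk hl
    simp only [Finset.mem_image, Finset.mem_product, Set.Finite.mem_toFinset, Prod.exists]
    rintro _ ⟨x, y, ⟨hx, hy⟩, rfl⟩ ⟨x', y', ⟨hx', hy'⟩, h⟩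
    rcases hkl.lt_or_gt with hkl | hkl
    · exact hne k l hkl hl x hx y hy x' hx' y' hy' h.symm
    · exact hne l k hkl hk x' hx' y' hy' x hx y hy h

theorem ncard_isNCTreeOn_edge (a m : ℕ) :
    {G | IsNCTreeOn a (a + m + 1) G ∧ G.Adj a (a + m + 1)}.ncard =
      ∑ k ∈ Finset.range (m + 1), A (k + 1) * A (m - k + 1) := by
  have hsum : ∀ k ∈ Finset.range (m + 1), A (k + 1) * A (m - k + 1) =
      {G | IsNCTreeOn a (a + k) G}.ncard *
        {G | IsNCTreeOn (a + k + 1) (a + m + 1) G}.ncard := by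
    intro k hk
    rw [Finset.mem_range] at hk
    rw [ncard_isNCTreeOn, show a + m + 1 = a + k + 1 + (m - k) by omega, ncard_isNCTreeOn]
  rw [Finset.sum_congr rfl hsum]
  refine ncard_eq_sum_mul (m + 1) (fun _ G₁ G₂ => G₁ ⊔ G₂ ⊔ edge a (a + m + 1))
    (fun _ => finite_setOf_isNCTreeOn _ _) (fun _ => finite_setOf_isNCTreeOn _ _) ?_ ?_ ?_ ?_
  · intro k hk G₁ h₁ G₂ h₂
    refine ⟨h₁.sup_edge h₂ (by omega) (by omega), ?_⟩
    rw [sup_adj, edge_adj]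
    omega
  · intro k l hkl hl G₁ h₁ G₂ h₂ G₁' h₁' G₂' h₂' h
    obtain ⟨x, y, hxy, -, hx, hy⟩ :=
      (h₁'.conn (a + l) (by omega) le_rfl).exists_adj_of_not (· ≤ a + k) (by omega) (by omega)
    have hs := h₁'.supp' hxy
    have : (G₁ ⊔ G₂ ⊔ edge a (a + m + 1)).Adj x y := h ▸ Or.inl (Or.inl hxy)
    rcases this with (hxy | hxy) | hxy
    · have := h₁.supp' hxy
      omega
    · have := h₂.supp' hxy
      omega
    · rw [edge_adj] at hxy
      omega
  · intro k hk G₁ h₁ G₂ h₂ G₁' h₁' G₂' h₂' h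
    have hadj : ∀ x y, (G₁ ⊔ G₂ ⊔ edge a (a + m + 1)).Adj x y ↔
      (G₁' ⊔ G₂' ⊔ edge a (a + m + 1)).Adj x y := fun x y => by rw [h]
    simp only [sup_adj, edge_adj] at hadj
    constructor <;> ext x y
    · have := hadj x y
      have := h₁.supp' (x := x) (y := y)
      have := h₂.supp' (x := x) (y := y)
      have := h₁'.supp' (x := x) (y := y)
      have := h₂'.supp' (x := x) (y := y)
      grind
    · have := hadj x y
      have := h₁.supp' (x := x) (y := y)
      have := h₂.supp' (x := x) (y := y)
      have := h₁'.supp' (x := x) (y := y)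
      have := h₂'.supp' (x := x) (y := y)
      grind
  · rintro G ⟨hG, hab⟩
    obtain ⟨k, hak, hkb, h₁, h₂, h⟩ := hG.exists_eq_sup_edge hab (by omega)
    obtain ⟨k, rfl⟩ := Nat.exists_eq_add_of_le hak
    exact ⟨k, by omega, _, h₁, _, h₂, h⟩

theorem ncard_isNCTreeOn_succ (a m : ℕ) :
    {G | IsNCTreeOn a (a + m + 1) G}.ncard =
      ∑ k ∈ Finset.range (m + 1), {G | IsNCTreeOn a (a + k + 1) G ∧ G.Adj a (a + k + 1)}.ncard *
        {G | IsNCTreeOn (a + k + 1) (a + m + 1) G}.ncard := by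
  refine ncard_eq_sum_mul (m + 1) (fun _ G₁ G₂ => G₁ ⊔ G₂)
    (fun _ => (finite_setOf_isNCTreeOn _ _).subset fun _ h => h.1)
    (fun _ => finite_setOf_isNCTreeOn _ _) ?_ ?_ ?_ ?_
  · intro k hk G₁ h₁ G₂ h₂
    exact h₁.1.sup h₂ (by omega) (by omega)
  · intro k l hkl hl G₁ h₁ G₂ h₂ G₁' h₁' G₂' h₂' h
    have : (G₁ ⊔ G₂).Adj a (a + l + 1) := h ▸ Or.inl h₁'.2
    rcases this with hxy | hxy
    · have := h₁.1.supp' hxy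
      omega
    · have := h₂.supp' hxy
      omega
  · intro k hk G₁ h₁ G₂ h₂ G₁' h₁' G₂' h₂' h
    have hadj : ∀ x y, (G₁ ⊔ G₂).Adj x y ↔ (G₁' ⊔ G₂').Adj x y := fun x y => by rw [h]
    simp only [sup_adj] at hadj
    constructor <;> ext x y
    · have := hadj x y
      have := h₁.1.supp' (x := x) (y := y)
      have := h₂.supp' (x := x) (y := y)
      have := h₁'.1.supp' (x := x) (y := y)
      have := h₂'.supp' (x := x) (y := y)
      grind
    · have := hadj x y
      have := h₁.1.supp' (x := x) (y := y)
      have := h₂.supp' (x := x) (y := y)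
      have := h₁'.1.supp' (x := x) (y := y)
      have := h₂'.supp' (x := x) (y := y)
      grind
  · intro G hG
    obtain ⟨k, hak, hkb, hk, hcov⟩ := IsNCTreeOn.exists_adj_not_covered hG (by omega)
    obtain ⟨k, rfl⟩ := Nat.exists_eq_add_of_le hak
    rw [show a + 1 + k = a + k + 1 by omega] at *
    exact ⟨k, by omega, _, ⟨hG.onInterval_left hkb hcov, hk, by omega, by omega⟩, _,
      hG.onInterval_right hak.le hcov, hG.onInterval_sup_onInterval hcov⟩

theorem ncard_isNCTreeOn_leaf_eq_sum (a m : ℕ) :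
    {G | IsNCTreeOn a (a + m + 1) G ∧ ∃ k, G.neighborSet a = {k}}.ncard =
      ∑ k ∈ Finset.range (m + 1), A (k + 1) * A (m - k + 1) := by
  have hsum : ∀ k ∈ Finset.range (m + 1), A (k + 1) * A (m - k + 1) =
      {G | IsNCTreeOn (a + 1) (a + 1 + k) G}.ncard *
        {G | IsNCTreeOn (a + 1 + k) (a + m + 1) G}.ncard := by
    intro k hk
    rw [Finset.mem_range] at hk
    rw [ncard_isNCTreeOn, show a + m + 1 = a + 1 + k + (m - k) by omega, ncard_isNCTreeOn]
  rw [Finset.sum_congr rfl hsum]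
  refine ncard_eq_sum_mul (m + 1) (fun k G₁ G₂ => G₁ ⊔ G₂ ⊔ edge a (a + 1 + k))
    (fun _ => finite_setOf_isNCTreeOn _ _) (fun _ => finite_setOf_isNCTreeOn _ _) ?_ ?_ ?_ ?_
  · intro k hk G₁ h₁ G₂ h₂
    refine ⟨h₁.sup_edge_leaf h₂ (by omega) (by omega), a + 1 + k, ?_⟩
    ext y
    have := h₁.supp' (x := a) (y := y)
    have := h₂.supp' (x := a) (y := y)
    simp only [mem_neighborSet, sup_adj, edge_adj, Set.mem_singleton_iff]
    grind
  · intro k l hkl hl G₁ h₁ G₂ h₂ G₁' h₁' G₂' h₂' h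
    have : (G₁ ⊔ G₂ ⊔ edge a (a + 1 + k)).Adj a (a + 1 + l) := by
      rw [h, sup_adj, edge_adj]
      omega
    rcases this with (hxy | hxy) | hxy
    · have := h₁.supp' hxy
      omega
    · have := h₂.supp' hxy
      omega
    · rw [edge_adj] at hxy
      omega
  · intro k hk G₁ h₁ G₂ h₂ G₁' h₁' G₂' h₂' h
    have hadj : ∀ x y, (G₁ ⊔ G₂ ⊔ edge a (a + 1 + k)).Adj x y ↔
      (G₁' ⊔ G₂' ⊔ edge a (a + 1 + k)).Adj x y := fun x y => by rw [h]
    simp only [sup_adj, edge_adj] at hadj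
    constructor <;> ext x y
    · have := hadj x y
      have := h₁.supp' (x := x) (y := y)
      have := h₂.supp' (x := x) (y := y)
      have := h₁'.supp' (x := x) (y := y)
      have := h₂'.supp' (x := x) (y := y)
      grind
    · have := hadj x y
      have := h₁.supp' (x := x) (y := y)
      have := h₂.supp' (x := x) (y := y)
      have := h₁'.supp' (x := x) (y := y)
      have := h₂'.supp' (x := x) (y := y)
      grind
  · rintro G ⟨hG, k, hk⟩
    obtain ⟨hak, hkb, h₁, h₂, h⟩ := hG.exists_eq_sup_edge_leaf hk
    obtain ⟨k, rfl⟩ := Nat.exists_eq_add_of_le hak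
    exact ⟨k, by omega, _, h₁, _, h₂, h⟩

end SimpleGraph

theorem A_one : A 1 = 1 := by
  have h : {G | SimpleGraph.IsNCTreeOn 0 (0 + 0) G} = {⊥} := by
    ext G
    rw [Set.mem_singleton_iff, Set.mem_ofPred_eq]
    constructor
    · intro hG
      ext x y
      have := hG.supp' (x := x) (y := y)
      simp only [SimpleGraph.bot_adj]
      grind
    · rintro rfl
      refine ⟨by simp, fun x _ hx => ?_, SimpleGraph.isAcyclic_bot, by simp⟩
      rw [show x = 0 by omega]
  rw [← SimpleGraph.ncard_isNCTreeOn 0 0, h, Set.ncard_singleton]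

theorem A_succ_succ (m : ℕ) :
    A (m + 2) = ∑ k ∈ Finset.range (m + 1),
      (∑ i ∈ Finset.range (k + 1), A (i + 1) * A (k - i + 1)) * A (m - k + 1) := by
  rw [← SimpleGraph.ncard_isNCTreeOn 0 (m + 1)]
  refine (SimpleGraph.ncard_isNCTreeOn_succ 0 m).trans (Finset.sum_congr rfl fun k hk => ?_)
  rw [Finset.mem_range] at hk
  rw [SimpleGraph.ncard_isNCTreeOn_edge, show 0 + m + 1 = 0 + k + 1 + (m - k) by omega,
    SimpleGraph.ncard_isNCTreeOn]

theorem A₁_succ_succ (m : ℕ) :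
    A₁ (m + 2) = ∑ k ∈ Finset.range (m + 1), A (k + 1) * A (m - k + 1) := by
  rw [← SimpleGraph.ncard_isNCTreeOn_leaf, ← SimpleGraph.ncard_isNCTreeOn_leaf_eq_sum 0 m,
    zero_add]

theorem A₁_one : A₁ 1 = 0 := by
  have : IsEmpty {G : SimpleGraph (ZMod 1) // IsNCTree G ∧ (G.neighborSet 0).ncard = 1} := by
    refine ⟨fun ⟨G, _, h⟩ => ?_⟩
    obtain ⟨x, hx⟩ := Set.ncard_eq_one.1 h
    have : G.Adj 0 x := by
      rw [← SimpleGraph.mem_neighborSet, hx]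
      rfl
    exact this.ne (Subsingleton.elim (α := Fin 1) _ _)
  exact Nat.card_of_isEmpty

open PowerSeries in
/-- Coefficients of powers of the generating function of ternary trees. -/
theorem fussCatalan_coeff_pow {B : PowerSeries ℚ} (hB : B = 1 + X * B ^ 3) (m r : ℕ) :
    ((3 * m + r : ℕ) : ℚ) * coeff m (B ^ r) = r * ((3 * m + r).choose m : ℚ) := by
  have hrec (m r : ℕ) :
      coeff (m + 1) (B ^ (r + 1)) = coeff (m + 1) (B ^ r) + coeff m (B ^ (r + 3)) := by
    have : B ^ (r + 1) = B ^ r + X * B ^ (r + 3) := by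
      calc B ^ (r + 1) = B ^ r * B := pow_succ B r
        _ = B ^ r * (1 + X * B ^ 3) := by rw [← hB]
        _ = _ := by ring
    rw [this, map_add, coeff_succ_X_mul]
  induction m generalizing r with
  | zero =>
    have : constantCoeff B = 1 := by rw [hB]; simp
    simp [this]
  | succ m ihm =>
    induction r with
    | zero => simp [coeff_one]
    | succ r ihr =>
      rw [hrec]
      have h1 := ihm (r + 3)
      have e1 := Nat.choose_succ_right_eq (3 * m + r + 3) m
      have e2 := Nat.choose_succ_succ (3 * m + r + 3) m
      rw [show 3 * m + (r + 3) = 3 * m + r + 3 by ring] at h1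
      rw [show 3 * (m + 1) + r = 3 * m + r + 3 by ring] at ihr
      rw [show 3 * (m + 1) + (r + 1) = 3 * m + r + 3 + 1 by ring]
      rw [show 3 * m + r + 3 - m = 2 * m + r + 3 by omega] at e1
      have e1' := congrArg (Nat.cast (R := ℚ)) e1
      have e2' := congrArg (Nat.cast (R := ℚ)) e2
      simp only [Nat.succ_eq_add_one] at e2'
      push_cast at *
      rw [e2']
      have hN : (3 * m + r + 3 : ℚ) ≠ 0 := by positivity
      have hM : (m + 1 : ℚ) ≠ 0 := by positivity
      apply mul_left_cancel₀ hN
      apply mul_left_cancel₀ hM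
      set c := ((3 * m + r + 3).choose m : ℚ)
      set d := ((3 * m + r + 3).choose (m + 1) : ℚ)
      linear_combination (m + 1 : ℚ) * (3 * m + r + 4) * (h1 + ihr) - 3 * (m + 1 : ℚ) * e1'

/-- The generating function of the numbers of noncrossing trees, counted by edges. -/
noncomputable def ncTreeSeries : PowerSeries ℚ :=
  PowerSeries.mk fun m => (A (m + 1) : ℚ)

theorem coeff_ncTreeSeries_sq (m : ℕ) :
    PowerSeries.coeff m (ncTreeSeries ^ 2) =
      ((∑ k ∈ Finset.range (m + 1), A (k + 1) * A (m - k + 1) : ℕ) : ℚ) := by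
  rw [sq, PowerSeries.coeff_mul, Finset.Nat.sum_antidiagonal_eq_sum_range_succ_mk]
  simp [ncTreeSeries]

theorem ncTreeSeries_eq : ncTreeSeries = 1 + PowerSeries.X * ncTreeSeries ^ 3 := by
  ext m
  cases m with
  | zero => simp [ncTreeSeries, A_one]
  | succ m =>
    rw [map_add, PowerSeries.coeff_succ_X_mul, pow_succ, PowerSeries.coeff_mul,
      Finset.Nat.sum_antidiagonal_eq_sum_range_succ_mk]
    simp only [coeff_ncTreeSeries_sq]
    simp [ncTreeSeries, PowerSeries.coeff_one, A_succ_succ]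

theorem A₁_closed_form :
    A₁ 1 = 0 ∧
    ∀ n : ℕ, 2 ≤ n → (3 * n - 4) * A₁ n = 2 * Nat.choose (3 * n - 4) (n - 2) := by
  refine ⟨A₁_one, fun n hn => ?_⟩
  obtain ⟨m, rfl⟩ := Nat.exists_eq_add_of_le' hn
  have h := fussCatalan_coeff_pow ncTreeSeries_eq m 2
  rw [coeff_ncTreeSeries_sq, ← A₁_succ_succ] at h
  rw [show 3 * (m + 2) - 4 = 3 * m + 2 by omega, Nat.add_sub_cancel]
  exact_mod_cast h
end

section
/- Let A^r(n) be the number of orbits of the rotation action of ℤ/nℤ on the set of n-noncrossing trees. Then n·A^r(n) = A(n) when n is odd, and n·A^r(n) = A(n) + (n/2)·A_1(n/2 + 1) when n is even; equivalently, A^r(n) = (1/n)·(A(n) + 1_{n even}·(n/2)·A_1(n/2 + 1)). -/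
/-- Rotation by `j`: the image of a graph on `ZMod n` under the vertex map `v ↦ v + j`. -/
def rotate {n : ℕ} (j : ZMod n) (G : SimpleGraph (ZMod n)) : SimpleGraph (ZMod n) :=
  G.map (Equiv.addRight j).toEmbedding

/-- `Ar n` is the number of orbits of the rotation action of `ℤ/nℤ`
on the set of `n`-noncrossing trees. -/
noncomputable def Ar (n : ℕ) : ℕ :=
  Nat.card {s : Set {G : SimpleGraph (ZMod n) // IsNCTree G} //
    ∃ G : {G : SimpleGraph (ZMod n) // IsNCTree G},
      s = {H | ∃ j : ZMod n, rotate j G.1 = H.1}}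

open SimpleGraph

/-! ### Graphs: reachability along boundaries and contracting maps -/

theorem exists_adj_of_reachable {V : Type*} {G : SimpleGraph V} {S : Set V} {u v : V}
    (h : G.Reachable u v) (hu : u ∈ S) (hv : v ∉ S) :
    ∃ p q, G.Reachable u p ∧ G.Adj p q ∧ p ∈ S ∧ q ∉ S := by
  rw [reachable_iff_reflTransGen] at h
  induction h with
  | refl => exact absurd hu hv
  | @tail b c hb hbc ih =>
    by_cases hS : b ∈ S
    · exact ⟨b, c, (reachable_iff_reflTransGen _ _).2 hb, hbc, hS, hv⟩
    · exact ih hS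

theorem reachable_of_contracting {V W : Type*} {G : SimpleGraph V} {H : SimpleGraph W} (f : V → W)
    (hf : ∀ a b, G.Adj a b → f a = f b ∨ H.Adj (f a) (f b)) {u v : V} (h : G.Reachable u v) :
    H.Reachable (f u) (f v) := by
  rw [reachable_iff_reflTransGen] at h
  induction h with
  | refl => rfl
  | tail _ hbc ih =>
    rcases hf _ _ hbc with h | h
    · rwa [← h]
    · exact ih.trans h.reachable

/-! ### Arithmetic of representatives in `ZMod n` -/

theorem val_sub_eq_ite {n : ℕ} [NeZero n] (a b : ZMod n) :
    (a - b).val = if b.val ≤ a.val then a.val - b.val else a.val + n - b.val := by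
  split_ifs with h
  · exact ZMod.val_sub h
  · have hb := ZMod.val_lt b
    have ha := ZMod.val_lt a
    have : a - b = ((a.val + n - b.val : ℕ) : ZMod n) := by
      rw [Nat.cast_sub (by omega)]; simp
    rw [this, ZMod.val_cast_of_lt (by omega)]

theorem val_add_eq_ite {n : ℕ} [NeZero n] (a b : ZMod n) :
    (a + b).val = if a.val + b.val < n then a.val + b.val else a.val + b.val - n := by
  split_ifs with h
  · exact ZMod.val_add_of_lt h
  · exact ZMod.val_add_of_le (by omega)

theorem val_ne_of_ne {n : ℕ} [NeZero n] {a b : ZMod n} (h : a ≠ b) : a.val ≠ b.val :=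
  fun h' => h (ZMod.val_injective n h')

/-! ### Rotation -/

theorem rotate_adj {n : ℕ} (j : ZMod n) (G : SimpleGraph (ZMod n)) (x y : ZMod n) :
    (rotate j G).Adj x y ↔ G.Adj (x - j) (y - j) := by
  have := SimpleGraph.map_adj_apply (G := G) (f := (Equiv.addRight j).toEmbedding)
    (a := x - j) (b := y - j)
  simpa [rotate] using this

theorem rotate_zero {n : ℕ} (G : SimpleGraph (ZMod n)) : rotate 0 G = G := by
  ext x y; simp [rotate_adj]

theorem rotate_rotate {n : ℕ} (i j : ZMod n) (G : SimpleGraph (ZMod n)) :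
    rotate i (rotate j G) = rotate (i + j) G := by
  ext x y; simp [rotate_adj, sub_sub]

theorem adj_add_of_rotate_eq {n : ℕ} {j : ZMod n} {G : SimpleGraph (ZMod n)}
    (h : rotate j G = G) {x y : ZMod n} : G.Adj (x + j) (y + j) ↔ G.Adj x y := by
  conv_lhs => rw [← h, rotate_adj]
  simp

theorem reachable_rotate {n : ℕ} (j : ZMod n) {G : SimpleGraph (ZMod n)} {x y : ZMod n} :
    (rotate j G).Reachable x y ↔ G.Reachable (x - j) (y - j) := by
  constructor
  · exact reachable_of_contracting (· - j) fun a b h => Or.inr ((rotate_adj j G a b).1 h)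
  · intro h
    have := reachable_of_contracting (H := rotate j G) (· + j)
      (fun a b h => Or.inr ((rotate_adj j G _ _).2 (by simpa using h))) h
    simpa using this

theorem Noncrossing.rotate {n : ℕ} [NeZero n] {G : SimpleGraph (ZMod n)} (h : Noncrossing G)
    (j : ZMod n) : Noncrossing (rotate j G) := by
  rintro a b c d hab hcd ⟨h1, h2, h3⟩
  rw [rotate_adj] at hab hcd
  have ha := val_sub_eq_ite a j
  have hb := val_sub_eq_ite b j
  have hc := val_sub_eq_ite c j
  have hd := val_sub_eq_ite d j
  have := ZMod.val_lt d
  have := ZMod.val_lt j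
  have e1 := h _ _ _ _ hab hcd
  have e2 := h _ _ _ _ hcd hab.symm
  have e3 := h _ _ _ _ hab.symm hcd.symm
  have e4 := h _ _ _ _ hcd.symm hab
  split_ifs at ha hb hc hd <;> omega

theorem IsNCTree.rotate {n : ℕ} [NeZero n] {G : SimpleGraph (ZMod n)} (h : IsNCTree G)
    (j : ZMod n) : IsNCTree (rotate j G) :=
  ⟨(Iso.map (Equiv.addRight j) G).isTree_iff.1 h.1, h.2.rotate j⟩

/-! ### Burnside's lemma -/

instance ncTreeAddAction (n : ℕ) [NeZero n] :
    AddAction (ZMod n) {G : SimpleGraph (ZMod n) // IsNCTree G} where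
  vadd j G := ⟨rotate j G.1, G.2.rotate j⟩
  zero_vadd G := Subtype.ext (rotate_zero G.1)
  add_vadd i j G := Subtype.ext (rotate_rotate i j G.1).symm

theorem coe_vadd_ncTree {n : ℕ} [NeZero n] (j : ZMod n)
    (G : {G : SimpleGraph (ZMod n) // IsNCTree G}) : (j +ᵥ G).1 = rotate j G.1 := rfl

theorem Ar_eq_card_quotient (n : ℕ) [NeZero n] :
    Ar n = Nat.card (AddAction.orbitRel.Quotient (ZMod n)
      {G : SimpleGraph (ZMod n) // IsNCTree G}) := by
  symm
  have horb (G : {G : SimpleGraph (ZMod n) // IsNCTree G}) :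
      AddAction.orbit (ZMod n) G = {H | ∃ j : ZMod n, rotate j G.1 = H.1} := by
    ext H
    simp [AddAction.mem_orbit_iff, Subtype.ext_iff, coe_vadd_ncTree]
  refine Nat.card_eq_of_bijective (fun q => ⟨q.orbit, ?_⟩) ⟨?_, ?_⟩
  · induction q using Quotient.inductionOn' with
    | h G => exact ⟨G, by rw [← horb]; rfl⟩
  · intro a b h
    exact AddAction.orbitRel.Quotient.orbit_injective (congrArg Subtype.val h)
  · rintro ⟨s, G, rfl⟩
    exact ⟨Quotient.mk'' G, Subtype.ext (horb G)⟩

/-- The number of noncrossing trees on `ZMod n` that are invariant under rotation by `j`. -/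
noncomputable def fixedCount (n : ℕ) (j : ZMod n) : ℕ :=
  Nat.card {G : SimpleGraph (ZMod n) // IsNCTree G ∧ rotate j G = G}

theorem fixedCount_zero (n : ℕ) : fixedCount n 0 = A n := by
  simp [fixedCount, A, rotate_zero]

theorem mul_Ar_eq_sum (n : ℕ) [NeZero n] : n * Ar n = ∑ j : ZMod n, fixedCount n j := by
  classical
  have := Fintype.ofFinite {G : SimpleGraph (ZMod n) // IsNCTree G}
  have := Fintype.ofFinite (Quotient (AddAction.orbitRel (ZMod n)
      {G : SimpleGraph (ZMod n) // IsNCTree G}))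
  have hb := AddAction.sum_card_fixedBy_eq_card_orbits_mul_card_addGroup (ZMod n)
    {G : SimpleGraph (ZMod n) // IsNCTree G}
  rw [Ar_eq_card_quotient, mul_comm, Nat.card_eq_fintype_card]
  rw [ZMod.card] at hb
  refine hb.symm.trans (Finset.sum_congr rfl fun j _ => ?_)
  rw [fixedCount, ← Nat.card_eq_fintype_card]
  refine Nat.card_congr ((Equiv.subtypeEquivRight fun G => ?_).trans
    (Equiv.subtypeSubtypeEquivSubtypeInter _ fun G => rotate j G = G))
  rw [AddAction.mem_fixedBy, Subtype.ext_iff, coe_vadd_ncTree]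

/-! ### Invariant trees contain a diameter -/

theorem eq_of_diameters {n : ℕ} [NeZero n] {G : SimpleGraph (ZMod n)} (hG : Noncrossing G)
    {a d j : ZMod n} (hd : d + d = 0) (hd0 : d ≠ 0) (hj0 : j ≠ 0)
    (h1 : G.Adj a (a + d)) (h2 : G.Adj (a + j) (a + j + d)) : j = d := by
  by_contra hjd
  have hN := hG.rotate (-a)
  have e1 : (rotate (-a) G).Adj 0 d := by
    rw [rotate_adj]; simpa [add_comm] using h1
  have e2 : (rotate (-a) G).Adj j (j + d) := by
    rw [rotate_adj]
    convert h2 using 1 <;> ring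
  have v1 := val_add_eq_ite d d
  have v2 := val_add_eq_ite j d
  have v3 := val_ne_of_ne hd0
  have v4 := val_ne_of_ne hj0
  have v5 := val_ne_of_ne hjd
  rw [hd] at v1
  rw [ZMod.val_zero] at v1 v3 v4
  have := ZMod.val_lt d
  have := ZMod.val_lt j
  have c1 := hN _ _ _ _ e1 e2
  have c2 := hN _ _ _ _ e1 e2.symm
  rw [ZMod.val_zero] at c1 c2
  split_ifs at v1 v2 <;> omega

theorem exists_fixed_edge {n : ℕ} [NeZero n] {G : SimpleGraph (ZMod n)} (hG : G.IsTree)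
    {j : ZMod n} {p : ℕ} [hp : Fact p.Prime] (hj : addOrderOf j = p) (hfix : rotate j G = G) :
    ∃ c, G.Adj c (c + j) ∧ j + j = 0 := by
  classical
  have := Fintype.ofFinite G.edgeSet
  let f : Function.End G.edgeSet := fun e => ⟨Sym2.map (· + j) e.1, by
    obtain ⟨e, he⟩ := e
    induction e with
    | h x y => simpa [adj_add_of_rotate_eq hfix] using he⟩
  have hval (k : ℕ) (e : G.edgeSet) : ((f ^ k) e).1 = Sym2.map (· + k • j) e.1 := by
    induction k generalizing e with
    | zero => simp only [pow_zero, zero_smul, add_zero, Sym2.map_id']; rfl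
    | succ k ih =>
      rw [pow_succ]
      change ((f ^ k) (f e)).1 = _
      rw [ih]
      change Sym2.map _ (Sym2.map _ _) = _
      rw [Sym2.map_map]
      congr 1
      funext x
      simp [add_mul]; ring
  have hf : f ^ p ^ 1 = 1 := by
    funext e
    apply Subtype.ext
    rw [hval, pow_one, ← hj, addOrderOf_nsmul_eq_zero]
    simp only [add_zero, Sym2.map_id']
    rfl
  have hmod := Equiv.Perm.card_fixedPoints_modEq hf
  have hcard : Fintype.card G.edgeSet + 1 = n := by
    have := hG.card_edgeFinset
    rwa [SimpleGraph.edgeFinset_card, ZMod.card] at this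
  have hpn : p ∣ n := by
    rw [← hj]; simpa using addOrderOf_dvd_card (x := j)
  have hne : Fintype.card (Function.fixedPoints f) ≠ 0 := by
    intro h0
    rw [h0, Nat.modEq_zero_iff_dvd] at hmod
    rw [← hcard] at hpn
    exact hp.out.one_lt.ne' (Nat.dvd_one.1 ((Nat.dvd_add_right hmod).1 hpn))
  obtain ⟨⟨⟨e, he⟩, hfe⟩⟩ := Fintype.card_pos_iff.1 (Nat.pos_of_ne_zero hne)
  have hj0 : j ≠ 0 := by
    rintro rfl
    rw [addOrderOf_zero] at hj
    exact hp.out.one_lt.ne hj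
  induction e with
  | h x y =>
    have h1 : Sym2.map (· + j) s(x, y) = s(x, y) := congrArg Subtype.val hfe
    simp [hj0] at h1
    refine ⟨x, by rw [h1.1]; exact he, ?_⟩
    have h2 := h1.2
    rw [← h1.1, add_assoc] at h2
    simpa using h2

theorem exists_diameter {n : ℕ} [NeZero n] {G : SimpleGraph (ZMod n)} (hG : IsNCTree G)
    {j : ZMod n} (hj : j ≠ 0) (hfix : rotate j G = G) :
    j + j = 0 ∧ ∃ c, G.Adj c (c + j) := by
  have hd1 : addOrderOf j ≠ 1 := by simpa using hj
  obtain ⟨p, hp, k, hk⟩ := Nat.exists_prime_and_dvd hd1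
  have := Fact.mk hp
  have hpos : 0 < addOrderOf j := addOrderOf_pos j
  have hk0 : k ≠ 0 := by rintro rfl; simp [hk] at hpos
  have hord : addOrderOf (k • j) = p := by
    rw [addOrderOf_nsmul' j hk0, hk, Nat.gcd_mul_left_left,
      Nat.mul_div_cancel _ (Nat.pos_of_ne_zero hk0)]
  have hfixk (i : ℕ) : rotate (i • j) G = G := by
    induction i with
    | zero => simp [rotate_zero]
    | succ i ih => rw [succ_nsmul, ← rotate_rotate, hfix, ih]
  obtain ⟨c, hc, h2⟩ := exists_fixed_edge hG.1 hord (hfixk k)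
  have hk' : k • j ≠ 0 := by
    intro h0
    rw [h0, addOrderOf_zero] at hord
    exact hp.one_lt.ne hord
  have hc' : G.Adj (c + j) (c + j + k • j) := by
    rw [add_right_comm]; exact (adj_add_of_rotate_eq hfix).2 hc
  have := eq_of_diameters hG.2 h2 hk' hj hc hc'
  rw [← this] at h2 hc
  exact ⟨h2, c, hc⟩

/-! ### Cutting an invariant tree along its diameter -/

theorem Noncrossing.reachable_of_separated {n : ℕ} [NeZero n] {H : SimpleGraph (ZMod n)}
    (hH : Noncrossing H) {p q y w : ZMod n} (hpq : H.Adj p q)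
    (hyw : H.Reachable y w) (hy : p.val < y.val ∧ y.val < q.val)
    (hw : ¬(p.val < w.val ∧ w.val < q.val)) : H.Reachable y p := by
  by_contra hyp
  obtain ⟨r, s, hyr, hrs, hr, hs⟩ := exists_adj_of_reachable
    (S := {v | p.val < v.val ∧ v.val < q.val}) hyw ⟨hy.1, hy.2⟩ fun h => hw ⟨h.1, h.2⟩
  have hys := hyr.trans hrs.reachable
  have hsp : s.val ≠ p.val := val_ne_of_ne (by rintro rfl; exact hyp hys)
  have hsq : s.val ≠ q.val :=
    val_ne_of_ne (by rintro rfl; exact hyp (hys.trans hpq.symm.reachable))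
  simp only [Set.mem_ofPred_eq] at hr hs
  have c1 := hH _ _ _ _ hpq hrs
  have c2 := hH _ _ _ _ hrs.symm hpq
  omega

theorem Noncrossing.reachable_of_interlace {n : ℕ} [NeZero n] {H : SimpleGraph (ZMod n)}
    (hH : Noncrossing H) {x y z w : ZMod n} (h1 : x.val < y.val) (h2 : y.val < z.val)
    (h3 : z.val < w.val) (hxz : H.Reachable x z) (hyw : H.Reachable y w) : H.Reachable x y := by
  by_contra hxy
  have hval {u v : ZMod n} (hu : H.Reachable x u) (hv : H.Reachable y v) : u.val ≠ v.val :=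
    val_ne_of_ne (by rintro rfl; exact hxy (hu.trans hv.symm))
  obtain ⟨p, q, hzp, hpq, hp, hq⟩ := exists_adj_of_reachable
    (S := {v | y.val < v.val ∧ v.val < w.val}) hxz.symm ⟨h2, h3⟩ (fun h => by
      have := h.1
      omega)
  have hxp : H.Reachable x p := hxz.trans hzp
  have hxq : H.Reachable x q := hxp.trans hpq.reachable
  have hqy := hval hxq (Reachable.refl y)
  have hqw := hval hxq hyw
  simp only [Set.mem_ofPred_eq] at hp hq
  rcases lt_or_ge q.val y.val with h | h
  · exact hxy (hxq.trans (hH.reachable_of_separated hpq.symm hyw (by omega) (by omega)).symm)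
  · exact hxy (hxp.trans ((hH.reachable_of_separated hpq hyw.symm (by omega) (by omega)).symm.trans
      hyw.symm))

/-! ### Half-turns, and folding along them -/

section Half

variable {m : ℕ}

theorem half_add_half : (m : ZMod (2 * m)) + m = 0 := by
  have := ZMod.natCast_self (2 * m)
  push_cast at this
  linear_combination this

/-- The vertex of `ZMod (m + 1)` obtained by folding `ZMod (2 * m)` onto `1, …, m`. -/
def foldVertex (x : ZMod (2 * m)) : ZMod (m + 1) := ((x.val % m + 1 : ℕ) : ZMod (m + 1))

/-- The vertex of the first half of `ZMod (2 * m)` lying over a nonzero vertex. -/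
def liftVertex (a : ZMod (m + 1)) : ZMod (2 * m) := ((a.val - 1 : ℕ) : ZMod (2 * m))

/-- The first half of `G`, with the vertex `0` attached to the ends of diameters. -/
def foldTree (G : SimpleGraph (ZMod (2 * m))) : SimpleGraph (ZMod (m + 1)) where
  Adj a b := (a ≠ 0 ∧ b ≠ 0 ∧ G.Adj (liftVertex a) (liftVertex b)) ∨
    (a = 0 ∧ b ≠ 0 ∧ G.Adj (liftVertex b) (liftVertex b + m)) ∨
    (b = 0 ∧ a ≠ 0 ∧ G.Adj (liftVertex a) (liftVertex a + m))
  symm := ⟨by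
    rintro a b (⟨ha, hb, h⟩ | h | h)
    · exact Or.inl ⟨hb, ha, h.symm⟩
    · exact Or.inr (Or.inr h)
    · exact Or.inr (Or.inl h)⟩
  loopless := ⟨by
    rintro a (⟨-, -, h⟩ | ⟨h1, h2, -⟩ | ⟨h1, h2, -⟩)
    · exact G.irrefl h
    · exact h2 h1
    · exact h2 h1⟩

theorem foldTree_adj_of_ne {G : SimpleGraph (ZMod (2 * m))} {a b : ZMod (m + 1)} (ha : a ≠ 0)
    (hb : b ≠ 0) : (foldTree G).Adj a b ↔ G.Adj (liftVertex a) (liftVertex b) := by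
  simp [foldTree, ha, hb]

theorem foldTree_adj_zero {G : SimpleGraph (ZMod (2 * m))} {b : ZMod (m + 1)} (hb : b ≠ 0) :
    (foldTree G).Adj 0 b ↔ G.Adj (liftVertex b) (liftVertex b + m) := by
  simp [foldTree, hb]

theorem add_half_add_half (x : ZMod (2 * m)) : x + m + m = x := by
  rw [add_assoc, half_add_half, add_zero]

theorem neg_half : -(m : ZMod (2 * m)) = m := neg_eq_of_add_eq_zero_left half_add_half

variable [NeZero m]

theorem val_half : (m : ZMod (2 * m)).val = m :=
  ZMod.val_cast_of_lt (by have := NeZero.pos m; omega)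

theorem half_ne_zero : (m : ZMod (2 * m)) ≠ 0 := by
  intro h
  have := val_half (m := m)
  rw [h, ZMod.val_zero] at this
  exact NeZero.ne m this.symm

theorem val_add_half (x : ZMod (2 * m)) :
    (x + m).val = if x.val < m then x.val + m else x.val - m := by
  have h := val_add_eq_ite x (m : ZMod (2 * m))
  rw [val_half] at h
  split_ifs at h ⊢ <;> omega

theorem eq_half_of_add_self {j : ZMod (2 * m)} (hj : j ≠ 0) (h : j + j = 0) : j = m := by
  apply ZMod.val_injective
  have h1 := val_add_eq_ite j j
  have h2 := val_ne_of_ne hj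
  have := ZMod.val_lt j
  rw [h] at h1
  rw [ZMod.val_zero] at h1 h2
  rw [val_half]
  split_ifs at h1 <;> omega

/-- Apart from diameters, no edge joins the vertices `0, …, m - 1` to the vertices
`m, …, 2 * m - 1`. -/
def IsHalved (G : SimpleGraph (ZMod (2 * m))) : Prop :=
  ∀ x y, G.Adj x y → y = x + m ∨ (x.val < m ↔ y.val < m)

theorem eq_zero_of_isHalved {G : SimpleGraph (ZMod (2 * m))} (hG : G.Connected) {h : ℕ}
    (hm : h < m) (h1 : IsHalved G) (h2 : IsHalved (rotate (-(h : ZMod (2 * m))) G)) :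
    h = 0 := by
  by_contra h0
  have hv : (h : ZMod (2 * m)).val = h := ZMod.val_cast_of_lt (by omega)
  obtain ⟨p, q, -, hpq, hp, hq⟩ := exists_adj_of_reachable
    (S := {x : ZMod (2 * m) | h ≤ x.val ∧ x.val < m ∨ h + m ≤ x.val})
    (hG.preconnected h 0) (by simp only [Set.mem_ofPred_eq, hv]; omega)
    (by simp only [Set.mem_ofPred_eq, ZMod.val_zero]; omega)
  simp only [Set.mem_ofPred_eq] at hp hq
  have e2 := h2 (p - h) (q - h) (by rw [rotate_adj]; simpa using hpq)
  have hdiam : ¬ q = p + m := by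
    rintro rfl
    rw [val_add_half] at hq
    have := ZMod.val_lt p
    split_ifs at hq <;> omega
  have e1 := (h1 p q hpq).resolve_left hdiam
  have e2 := e2.resolve_left fun e => hdiam (by linear_combination e)
  rw [val_sub_eq_ite, val_sub_eq_ite, hv] at e2
  have := ZMod.val_lt p
  have := ZMod.val_lt q
  split_ifs at e2 <;> omega

theorem exists_boundary {n : ℕ} [NeZero n] {C : Set (ZMod n)} {a b : ZMod n} (ha : a ∈ C)
    (hb : b ∉ C) : ∃ g, g ∈ C ∧ g - 1 ∉ C := by
  by_contra! h
  have hk (k : ℕ) : a - k ∈ C := by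
    induction k with
    | zero => simpa using ha
    | succ k ih =>
      have := h _ ih
      rwa [sub_sub, ← Nat.cast_succ] at this
  apply hb
  have := hk (a - b).val
  simpa using this

theorem exists_isHalved {G : SimpleGraph (ZMod (2 * m))} (hG : IsNCTree G)
    (hfix : rotate (m : ZMod (2 * m)) G = G) :
    ∃ g : ZMod (2 * m), IsHalved (rotate (-g) G) := by
  obtain ⟨-, c, hc⟩ := exists_diameter hG half_ne_zero hfix
  set H := G.deleteEdges {s(c, c + m)} with hHdef
  have hHG : H ≤ G := deleteEdges_le _
  have hHN : Noncrossing H := fun a b c d h1 h2 => hG.2 a b c d (hHG h1) (hHG h2)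
  have hadj (x y) (h : G.Adj x y) : H.Adj x y ∨ s(x, y) = s(c, c + m) := by
    simp only [hHdef, deleteEdges_adj, Set.mem_singleton_iff]
    tauto
  have hsep : ¬ H.Reachable c (c + m) :=
    isBridge_iff.1 (isAcyclic_iff_forall_adj_isBridge.1 hG.1.isAcyclic hc)
  have hcover (x) : H.Reachable c x ∨ H.Reachable (c + m) x := by
    by_contra hx
    obtain ⟨p, q, -, hpq, hp, hq⟩ := exists_adj_of_reachable
      (S := {x | H.Reachable c x ∨ H.Reachable (c + m) x}) (hG.1.connected.preconnected c x)
      (Or.inl (Reachable.refl c)) hx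
    rcases hadj p q hpq with h | h
    · exact hq (hp.imp (fun h' => h'.trans h.reachable) (fun h' => h'.trans h.reachable))
    · rcases Sym2.eq_iff.1 h with ⟨-, rfl⟩ | ⟨-, rfl⟩
      · exact hq (Or.inr (Reachable.refl _))
      · exact hq (Or.inl (Reachable.refl _))
  have hHfix {x y} (h : H.Reachable x y) : H.Reachable (x + m) (y + m) := by
    refine reachable_of_contracting (· + (m : ZMod (2 * m))) (fun a b hab => Or.inr ?_) h
    rcases hadj _ _ ((adj_add_of_rotate_eq hfix).2 (hHG hab)) with h' | h'
    · exact h'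
    · exfalso
      have : s(a, b) = s(c, c + m) := by
        rw [Sym2.eq_iff] at h' ⊢
        rcases h' with ⟨h1, h2⟩ | ⟨h1, h2⟩
        · right
          exact ⟨by rw [← h1, add_half_add_half], add_right_cancel h2 ▸ (by
            rw [← add_half_add_half b, h2, add_half_add_half])⟩
        · left
          exact ⟨add_right_cancel h1, by rw [← h2, add_half_add_half]⟩
      simp [hHdef, this] at hab
  have hC (x) : H.Reachable c (x + m) ↔ ¬ H.Reachable c x := by
    constructor
    · intro h1 h2
      exact hsep (h1.trans (hHfix h2).symm)
    · intro h
      have := hHfix ((hcover x).resolve_left h)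
      rwa [add_half_add_half] at this
  obtain ⟨g, hg, hg'⟩ := exists_boundary (C := {x | H.Reachable c x}) (Reachable.refl c) hsep
  simp only [Set.mem_ofPred_eq] at hg hg'
  have hfirst (x : ZMod (2 * m)) (hx : x.val < m) : H.Reachable c (x + g) := by
    by_contra hxg
    have hpos := NeZero.pos m
    have hm1 : ((m - 1 : ℕ) : ZMod (2 * m)) = m - 1 := by
      rw [Nat.cast_sub hpos, Nat.cast_one]
    have hvm1 : ((m - 1 : ℕ) : ZMod (2 * m)).val = m - 1 := ZMod.val_cast_of_lt (by omega)
    have hgm : H.Reachable c (g + (m - 1 : ℕ)) := by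
      have := (hC (g - 1)).2 hg'
      rw [hm1]
      convert this using 1
      ring
    have hx0 : x.val ≠ (0 : ZMod (2 * m)).val := val_ne_of_ne (by
      rintro rfl; rw [zero_add] at hxg; exact hxg hg)
    have hxm : x.val ≠ ((m - 1 : ℕ) : ZMod (2 * m)).val := val_ne_of_ne (by
      rintro rfl; rw [add_comm] at hxg; exact hxg hgm)
    rw [ZMod.val_zero] at hx0
    have hneg : (-1 : ZMod (2 * m)).val = 2 * m - 1 := by
      have : (-1 : ZMod (2 * m)) = ((2 * m - 1 : ℕ) : ZMod (2 * m)) := by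
        rw [Nat.cast_sub (by omega), ZMod.natCast_self]; simp
      rw [this, ZMod.val_cast_of_lt (by omega)]
    have key := (hHN.rotate (-g)).reachable_of_interlace (x := 0) (y := x)
      (z := ((m - 1 : ℕ) : ZMod (2 * m))) (w := -1) (by rw [ZMod.val_zero]; omega) (by omega)
      (by omega)
      (by
        rw [reachable_rotate]
        have := hg.symm.trans hgm
        convert this using 1 <;> ring)
      (by
        have h1 := (hcover (x + g)).resolve_left hxg
        have h2 := (hcover (g - 1)).resolve_left hg'
        rw [reachable_rotate]
        have := h1.symm.trans h2
        convert this using 1 <;> ring)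
    rw [reachable_rotate] at key
    apply hxg
    have := hg.trans (by simpa using key)
    simpa using this
  have hiff (x : ZMod (2 * m)) : H.Reachable c (x + g) ↔ x.val < m := by
    refine ⟨fun h => ?_, hfirst x⟩
    by_contra hx
    have h1 := hfirst (x + m) (by
      rw [val_add_half, if_neg hx]
      have := ZMod.val_lt x
      omega)
    rw [add_right_comm, hC] at h1
    exact h1 h
  refine ⟨g, fun x y hxy => ?_⟩
  rw [rotate_adj, sub_neg_eq_add, sub_neg_eq_add] at hxy
  rcases hadj _ _ hxy with h | h
  · right
    rw [← hiff, ← hiff]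
    exact ⟨fun h' => h'.trans h.reachable, fun h' => h'.trans h.symm.reachable⟩
  · left
    rcases Sym2.eq_iff.1 h with ⟨h1, h2⟩ | ⟨h1, h2⟩
    · linear_combination h2 - h1
    · linear_combination h2 - h1 - half_add_half (m := m)

theorem exists_isHalved_lt {G : SimpleGraph (ZMod (2 * m))} (hG : IsNCTree G)
    (hfix : rotate (m : ZMod (2 * m)) G = G) :
    ∃ g : ℕ, g < m ∧ IsHalved (rotate (-(g : ZMod (2 * m))) G) := by
  obtain ⟨g, hg⟩ := exists_isHalved hG hfix
  by_cases h : g.val < m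
  · exact ⟨g.val, h, by simpa using hg⟩
  · have hv := val_add_half g
    rw [if_neg h] at hv
    refine ⟨(g + m).val, by have := ZMod.val_lt g; omega, ?_⟩
    rwa [ZMod.natCast_zmod_val, neg_add, neg_half, ← rotate_rotate, hfix]

variable (m) in
/-- The number of rotation-invariant noncrossing trees on `2 * m` vertices whose non-diameter
edges respect the cut of the circle into `0, …, m - 1` and `m, …, 2 * m - 1`. -/
noncomputable def halvedCount : ℕ :=
  Nat.card {G : SimpleGraph (ZMod (2 * m)) //
    IsNCTree G ∧ rotate (m : ZMod (2 * m)) G = G ∧ IsHalved G}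

theorem fixedCount_half : fixedCount (2 * m) m = m * halvedCount m := by
  rw [halvedCount, ← Nat.card_fin m, ← Nat.card_prod, Nat.card_fin, fixedCount]
  symm
  refine Nat.card_eq_of_bijective (fun a => ⟨rotate ((a.1 : ℕ) : ZMod (2 * m)) a.2.1,
    a.2.2.1.rotate _, ?_⟩) ⟨?_, ?_⟩
  · rw [rotate_rotate, add_comm, ← rotate_rotate, a.2.2.2.1]
  · have key (i j : Fin m) (G H : SimpleGraph (ZMod (2 * m))) (hG : IsHalved G)
        (hH : IsHalved H) (hHc : H.Connected) (hle : j ≤ i)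
        (h : rotate ((i : ℕ) : ZMod (2 * m)) G = rotate ((j : ℕ) : ZMod (2 * m)) H) : i = j := by
      have hGH : G = rotate (-((i - j : ℕ) : ZMod (2 * m))) H := by
        have := congrArg (rotate (-((i : ℕ) : ZMod (2 * m)))) h
        rw [rotate_rotate, rotate_rotate, neg_add_cancel, rotate_zero] at this
        rw [this, Nat.cast_sub hle]
        congr 1
        ring
      rw [hGH] at hG
      have h0 := eq_zero_of_isHalved hHc (by have := i.2; omega) hH hG
      apply Fin.ext
      have : (j : ℕ) ≤ i := hle
      omega
    rintro ⟨i, G, hG⟩ ⟨j, H, hH⟩ h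
    have h : rotate ((i : ℕ) : ZMod (2 * m)) G = rotate ((j : ℕ) : ZMod (2 * m)) H :=
      congrArg Subtype.val h
    have hij : i = j := by
      rcases le_total j i with hle | hle
      · exact key i j G H hG.2.2 hH.2.2 hH.1.1.connected hle h
      · exact (key j i H G hH.2.2 hG.2.2 hG.1.1.connected hle h.symm).symm
    subst hij
    have h := congrArg (rotate (-((i : ℕ) : ZMod (2 * m)))) h
    simp only [rotate_rotate, neg_add_cancel, rotate_zero] at h
    subst h
    rfl
  · rintro ⟨G, hG, hfix⟩
    obtain ⟨g, hg, hcut⟩ := exists_isHalved_lt hG hfix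
    refine ⟨⟨⟨g, hg⟩, rotate (-(g : ZMod (2 * m))) G, hG.rotate _, ?_, hcut⟩, ?_⟩
    · rw [rotate_rotate, add_comm, ← rotate_rotate, hfix]
    · apply Subtype.ext
      simp only [rotate_rotate, add_neg_cancel, rotate_zero]

/-! ### Halved trees and trees whose vertex `0` is a leaf -/

theorem val_foldVertex (x : ZMod (2 * m)) :
    (foldVertex x).val = if x.val < m then x.val + 1 else x.val - m + 1 := by
  have hpos := NeZero.pos m
  have hx := ZMod.val_lt x
  have hlt := Nat.mod_lt x.val hpos
  rw [foldVertex, ZMod.val_cast_of_lt (by omega)]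
  split_ifs with h
  · rw [Nat.mod_eq_of_lt h]
  · rw [Nat.mod_eq_sub_mod (by omega), Nat.mod_eq_of_lt (by omega)]

theorem foldVertex_ne_zero (x : ZMod (2 * m)) : foldVertex x ≠ 0 := by
  intro h
  have := val_foldVertex x
  rw [h, ZMod.val_zero] at this
  split_ifs at this

theorem val_liftVertex (a : ZMod (m + 1)) : (liftVertex a).val = a.val - 1 :=
  ZMod.val_cast_of_lt (by have := ZMod.val_lt a; have := NeZero.pos m; omega)

theorem val_liftVertex_lt (a : ZMod (m + 1)) : (liftVertex a).val < m := by
  have := ZMod.val_lt a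
  have := NeZero.pos m
  rw [val_liftVertex]
  omega

theorem val_pos_of_ne_zero {n : ℕ} [NeZero n] {a : ZMod n} (ha : a ≠ 0) : 0 < a.val := by
  have := val_ne_of_ne ha
  rw [ZMod.val_zero] at this
  omega

theorem foldVertex_add_half (x : ZMod (2 * m)) :
    foldVertex (x + (m : ZMod (2 * m))) = foldVertex x := by
  apply ZMod.val_injective
  have := ZMod.val_lt x
  rw [val_foldVertex, val_foldVertex, val_add_half]
  split_ifs <;> omega

theorem foldVertex_liftVertex {a : ZMod (m + 1)} (ha : a ≠ 0) :
    foldVertex (liftVertex a) = a := by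
  apply ZMod.val_injective
  have := val_pos_of_ne_zero ha
  rw [val_foldVertex, if_pos (val_liftVertex_lt a), val_liftVertex]
  omega

theorem liftVertex_foldVertex (x : ZMod (2 * m)) :
    liftVertex (foldVertex x) = if x.val < m then x else x + m := by
  apply ZMod.val_injective
  rw [val_liftVertex, val_foldVertex]
  split_ifs with h
  · omega
  · rw [val_add_half, if_neg h]
    omega

theorem eq_or_eq_of_foldVertex_eq {x y : ZMod (2 * m)} (h : foldVertex x = foldVertex y) :
    x = y ∨ x = y + m := by
  have hv := congrArg ZMod.val h
  rw [val_foldVertex, val_foldVertex] at hv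
  have hy := val_add_half y
  have := ZMod.val_lt x
  have := ZMod.val_lt y
  by_cases hxy : x.val = y.val
  · exact Or.inl (ZMod.val_injective _ hxy)
  · refine Or.inr (ZMod.val_injective _ ?_)
    split_ifs at hv hy <;> omega

/-- Two copies of `T` minus the vertex `0`, joined by the diameter through the neighbors
of `0`. -/
def unfoldTree (T : SimpleGraph (ZMod (m + 1))) : SimpleGraph (ZMod (2 * m)) where
  Adj x y := ((x.val < m ↔ y.val < m) ∧ T.Adj (foldVertex x) (foldVertex y)) ∨
    (y = x + m ∧ T.Adj 0 (foldVertex x))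
  symm := ⟨by
    rintro x y (⟨h1, h2⟩ | ⟨rfl, h⟩)
    · exact Or.inl ⟨h1.symm, h2.symm⟩
    · exact Or.inr ⟨(add_half_add_half x).symm, by rwa [foldVertex_add_half]⟩⟩
  loopless := ⟨by
    rintro x (⟨-, h⟩ | ⟨h, -⟩)
    · exact T.irrefl h
    · exact half_ne_zero (left_eq_add.1 h)⟩

theorem unfoldTree_adj (T : SimpleGraph (ZMod (m + 1))) (x y : ZMod (2 * m)) :
    (unfoldTree T).Adj x y ↔ ((x.val < m ↔ y.val < m) ∧ T.Adj (foldVertex x) (foldVertex y)) ∨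
      (y = x + m ∧ T.Adj 0 (foldVertex x)) := Iff.rfl

theorem not_iff_val_add_half (x : ZMod (2 * m)) : ¬ (x.val < m ↔ (x + m).val < m) := by
  rw [val_add_half]
  have := ZMod.val_lt x
  split_ifs <;> omega

theorem unfoldTree_adj_liftVertex (T : SimpleGraph (ZMod (m + 1))) {a b : ZMod (m + 1)}
    (ha : a ≠ 0) (hb : b ≠ 0) :
    (unfoldTree T).Adj (liftVertex a) (liftVertex b) ↔ T.Adj a b := by
  rw [unfoldTree_adj, foldVertex_liftVertex ha, foldVertex_liftVertex hb]
  have hiff : (liftVertex a).val < m ↔ (liftVertex b).val < m := by simp [val_liftVertex_lt]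
  constructor
  · rintro (⟨-, h⟩ | ⟨h, -⟩)
    · exact h
    · exact absurd (h ▸ hiff) (not_iff_val_add_half _)
  · exact fun h => Or.inl ⟨hiff, h⟩

theorem unfoldTree_adj_add_half (T : SimpleGraph (ZMod (m + 1))) (x : ZMod (2 * m)) :
    (unfoldTree T).Adj x (x + m) ↔ T.Adj 0 (foldVertex x) := by
  rw [unfoldTree_adj]
  have := not_iff_val_add_half x
  tauto

theorem rotate_unfoldTree (T : SimpleGraph (ZMod (m + 1))) :
    rotate (m : ZMod (2 * m)) (unfoldTree T) = unfoldTree T := by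
  ext x y
  have hx := not_iff_val_add_half x
  have hy := not_iff_val_add_half y
  rw [rotate_adj, sub_eq_add_neg, sub_eq_add_neg, neg_half, unfoldTree_adj, unfoldTree_adj,
    foldVertex_add_half, foldVertex_add_half, add_left_inj]
  tauto

theorem isHalved_unfoldTree (T : SimpleGraph (ZMod (m + 1))) : IsHalved (unfoldTree T) := by
  rintro x y (h | h)
  · exact Or.inr h.1
  · exact Or.inl h.1

theorem unfoldTree_injective :
    Function.Injective (unfoldTree : SimpleGraph (ZMod (m + 1)) → SimpleGraph (ZMod (2 * m))) := by
  intro T U h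
  have h0 (b : ZMod (m + 1)) (hb : b ≠ 0) : T.Adj 0 b ↔ U.Adj 0 b := by
    rw [← foldVertex_liftVertex hb, ← unfoldTree_adj_add_half, ← unfoldTree_adj_add_half, h]
  ext a b
  by_cases ha : a = 0
  · subst ha
    by_cases hb : b = 0
    · simp [hb]
    · exact h0 b hb
  · by_cases hb : b = 0
    · subst hb
      rw [T.adj_comm, U.adj_comm]
      exact h0 a ha
    · rw [← unfoldTree_adj_liftVertex T ha hb, ← unfoldTree_adj_liftVertex U ha hb, h]

theorem noncrossing_unfoldTree {T : SimpleGraph (ZMod (m + 1))} (hT : Noncrossing T)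
    {r : ZMod (m + 1)} (hr : ∀ b, T.Adj 0 b ↔ b = r) : Noncrossing (unfoldTree T) := by
  rintro a b c d hab hcd ⟨h1, h2, h3⟩
  have va := val_foldVertex a
  have vb := val_foldVertex b
  have vc := val_foldVertex c
  have vd := val_foldVertex d
  have := ZMod.val_lt d
  rcases hab with ⟨hi, hab⟩ | ⟨rfl, hab⟩ <;> rcases hcd with ⟨hj, hcd⟩ | ⟨rfl, hcd⟩
  · have := hT _ _ _ _ hab hcd
    split_ifs at va vb vc vd <;> omega
  · have := hT _ _ _ _ hcd hab
    rw [ZMod.val_zero] at this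
    rw [val_add_half] at h3
    split_ifs at va vb vc h3 <;> omega
  · have := hT _ _ _ _ hab hcd
    rw [ZMod.val_zero] at this
    rw [val_add_half] at h2 h3
    split_ifs at va vc vd h2 h3 <;> omega
  · rw [(hr _).1 hab] at va
    rw [(hr _).1 hcd] at vc
    rw [val_add_half] at h2 h3
    split_ifs at va vc h2 h3 <;> omega

theorem isTree_unfoldTree {T : SimpleGraph (ZMod (m + 1))} (hT : T.IsTree)
    {r : ZMod (m + 1)} (hr : ∀ b, T.Adj 0 b ↔ b = r) : (unfoldTree T).IsTree := by
  have hr0 : r ≠ 0 := ((hr r).2 rfl).ne'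
  have hdiam : (unfoldTree T).Adj (liftVertex r) (liftVertex r + m) := by
    rw [unfoldTree_adj_add_half, foldVertex_liftVertex hr0, hr]
  have hconn : (unfoldTree T).Connected := by
    have hcontr (a b : ZMod (m + 1)) (hab : T.Adj a b) :
        (if a = 0 then liftVertex r else liftVertex a) =
            (if b = 0 then liftVertex r else liftVertex b) ∨
          (unfoldTree T).Adj (if a = 0 then liftVertex r else liftVertex a)
            (if b = 0 then liftVertex r else liftVertex b) := by
      by_cases ha : a = 0
      · subst ha
        obtain rfl := (hr b).1 hab
        left
        simp
      · by_cases hb : b = 0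
        · subst hb
          obtain rfl := (hr a).1 hab.symm
          left
          simp
        · right
          rw [if_neg ha, if_neg hb]
          exact (unfoldTree_adj_liftVertex T ha hb).2 hab
    have hleft (x : ZMod (2 * m)) (hx : x.val < m) :
        (unfoldTree T).Reachable (liftVertex r) x := by
      have := reachable_of_contracting _ hcontr (hT.connected.preconnected r (foldVertex x))
      rwa [if_neg hr0, if_neg (foldVertex_ne_zero x), liftVertex_foldVertex, if_pos hx] at this
    have hall (x : ZMod (2 * m)) : (unfoldTree T).Reachable (liftVertex r) x := by
      by_cases hx : x.val < m
      · exact hleft x hx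
      · have h1 := hleft (x + m) (by
          have := not_iff_val_add_half x
          tauto)
        rw [← rotate_unfoldTree, reachable_rotate, add_sub_cancel_right, sub_eq_add_neg,
          neg_half] at h1
        exact hdiam.reachable.trans h1
    exact (connected_iff_exists_forall_reachable _).2 ⟨_, hall⟩
  refine isTree_iff_connected_and_card.2 ⟨hconn, le_antisymm ?_
    hconn.card_vert_le_card_edgeSet_add_one⟩
  have hTcard := (isTree_iff_connected_and_card.1 hT).2
  rw [Nat.card_zmod] at hTcard ⊢
  let f : ZMod (m + 1) → ZMod (2 * m) := fun a => if a = 0 then liftVertex r + m else liftVertex a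
  let g : ZMod (m + 1) → ZMod (2 * m) := fun a => f a + m
  have hdf : s(liftVertex r, liftVertex r + m) ∈ Set.image (Sym2.map f) T.edgeSet :=
    ⟨s(0, r), (hr r).2 rfl, by simp [f, hr0, Sym2.eq_swap]⟩
  have hdg : s(liftVertex r, liftVertex r + m) ∈ Set.image (Sym2.map g) T.edgeSet :=
    ⟨s(0, r), (hr r).2 rfl, by simp [f, g, hr0, add_half_add_half]⟩
  have hsub : (unfoldTree T).edgeSet ⊆ Set.image (Sym2.map f) T.edgeSet ∪ Set.image (Sym2.map g) T.edgeSet := by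
    rintro ⟨x, y⟩ (⟨hi, h⟩ | ⟨h, hx⟩)
    · by_cases hx : x.val < m
      · refine Or.inl ⟨s(foldVertex x, foldVertex y), h, ?_⟩
        simp [f, foldVertex_ne_zero, liftVertex_foldVertex, hx, hi.1 hx]
      · refine Or.inr ⟨s(foldVertex x, foldVertex y), h, ?_⟩
        have hy := mt hi.2 hx
        simp [f, g, foldVertex_ne_zero, liftVertex_foldVertex, hx, hy, add_half_add_half]
    · have hx : foldVertex x = foldVertex (liftVertex r) := by
        rw [foldVertex_liftVertex hr0]; exact (hr _).1 hx
      left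
      convert hdf using 1
      rcases eq_or_eq_of_foldVertex_eq hx with rfl | rfl
      · exact congrArg (s(liftVertex r, ·)) h
      · refine (congrArg (s(liftVertex r + (m : ZMod (2 * m)), ·)) h).trans ?_
        rw [add_half_add_half]
        exact Sym2.eq_swap
  have h1 := Set.ncard_le_ncard hsub (Set.toFinite _)
  have h2 := Set.ncard_union_add_ncard_inter (Set.image (Sym2.map f) T.edgeSet) (Set.image (Sym2.map g) T.edgeSet)
  have h3 : 0 < (Set.image (Sym2.map f) T.edgeSet ∩ Set.image (Sym2.map g) T.edgeSet).ncard :=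
    (Set.ncard_pos (Set.toFinite _)).2 ⟨_, hdf, hdg⟩
  have h4 := Set.ncard_image_le (f := Sym2.map f) (Set.toFinite T.edgeSet)
  have h5 := Set.ncard_image_le (f := Sym2.map g) (Set.toFinite T.edgeSet)
  rw [Nat.card_coe_set_eq] at hTcard ⊢
  omega

theorem unfoldTree_foldTree {G : SimpleGraph (ZMod (2 * m))}
    (hfix : rotate (m : ZMod (2 * m)) G = G) (hhalf : IsHalved G) :
    unfoldTree (foldTree G) = G := by
  ext x y
  rw [unfoldTree_adj, foldTree_adj_of_ne (foldVertex_ne_zero x) (foldVertex_ne_zero y),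
    foldTree_adj_zero (foldVertex_ne_zero x), liftVertex_foldVertex, liftVertex_foldVertex]
  have hx : G.Adj (if x.val < m then x else x + m) ((if x.val < m then x else x + m) + m) ↔
      G.Adj x (x + m) := by
    split_ifs
    · rfl
    · exact adj_add_of_rotate_eq hfix
  rw [hx]
  constructor
  · rintro (⟨hi, h⟩ | ⟨rfl, h⟩)
    · by_cases hx : x.val < m
      · rwa [if_pos hx, if_pos (hi.1 hx)] at h
      · rwa [if_neg hx, if_neg (mt hi.2 hx), adj_add_of_rotate_eq hfix] at h
    · exact h
  · intro h
    rcases hhalf x y h with rfl | hi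
    · exact Or.inr ⟨rfl, h⟩
    · refine Or.inl ⟨hi, ?_⟩
      by_cases hx : x.val < m
      · rwa [if_pos hx, if_pos (hi.1 hx)]
      · rwa [if_neg hx, if_neg (mt hi.2 hx), adj_add_of_rotate_eq hfix]

theorem exists_foldTree_adj_zero_iff {G : SimpleGraph (ZMod (2 * m))} (hG : IsNCTree G)
    (hfix : rotate (m : ZMod (2 * m)) G = G) :
    ∃ r : ZMod (m + 1), r ≠ 0 ∧ ∀ b, (foldTree G).Adj 0 b ↔ b = r := by
  obtain ⟨-, c, hc⟩ := exists_diameter hG half_ne_zero hfix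
  refine ⟨foldVertex c, foldVertex_ne_zero c, fun b => ?_⟩
  by_cases hb : b = 0
  · subst hb
    simp [(foldVertex_ne_zero c).symm]
  rw [foldTree_adj_zero hb]
  constructor
  · intro h
    rw [← foldVertex_liftVertex hb]
    by_cases hbc : liftVertex b = c
    · rw [hbc]
    · have := eq_of_diameters hG.2 half_add_half half_ne_zero (a := c) (j := liftVertex b - c)
        (sub_ne_zero.2 hbc) hc (by simpa using h)
      rw [sub_eq_iff_eq_add'.1 this, foldVertex_add_half]
  · rintro rfl
    rw [liftVertex_foldVertex]
    split_ifs
    · exact hc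
    · exact (adj_add_of_rotate_eq hfix).2 hc

theorem isNCTree_foldTree {G : SimpleGraph (ZMod (2 * m))} (hG : IsNCTree G)
    (hfix : rotate (m : ZMod (2 * m)) G = G) (hhalf : IsHalved G) : IsNCTree (foldTree G) := by
  obtain ⟨r, hr0, hr⟩ := exists_foldTree_adj_zero_iff hG hfix
  have hdiam := (foldTree_adj_zero hr0).1 ((hr r).2 rfl)
  refine ⟨⟨?_, ?_⟩, ?_⟩
  · let p : ZMod (2 * m) → ZMod (m + 1) := fun x => if x.val < m then foldVertex x else 0
    have hp (a : ZMod (m + 1)) : ∃ x, p x = a := by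
      by_cases ha : a = 0
      · exact ⟨m, by simp only [p, val_half, lt_irrefl, if_false, ha]⟩
      · exact ⟨liftVertex a, by simp [p, val_liftVertex_lt, foldVertex_liftVertex ha]⟩
    have hcontr (x y) (h : G.Adj x y) : p x = p y ∨ (foldTree G).Adj (p x) (p y) := by
      by_cases hx : x.val < m
      · by_cases hy : y.val < m
        · right
          simp only [p, hx, hy, if_true]
          rw [foldTree_adj_of_ne (foldVertex_ne_zero x) (foldVertex_ne_zero y),
            liftVertex_foldVertex, liftVertex_foldVertex, if_pos hx, if_pos hy]
          exact h
        · right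
          obtain rfl := (hhalf x y h).resolve_right (by tauto)
          simp only [p, hx, hy, if_true, if_false]
          rw [adj_comm, foldTree_adj_zero (foldVertex_ne_zero x), liftVertex_foldVertex,
            if_pos hx]
          exact h
      · by_cases hy : y.val < m
        · right
          obtain rfl := (hhalf y x h.symm).resolve_right (by tauto)
          simp only [p, hx, hy, if_true, if_false]
          rw [foldTree_adj_zero (foldVertex_ne_zero y), liftVertex_foldVertex, if_pos hy]
          exact h.symm
        · left
          simp [p, hx, hy]
    refine (connected_iff _).2 ⟨fun a b => ?_, inferInstance⟩
    obtain ⟨x, rfl⟩ := hp a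
    obtain ⟨y, rfl⟩ := hp b
    exact reachable_of_contracting p hcontr (hG.1.connected.preconnected x y)
  · let f : foldTree G →g G :=
      { toFun := fun a => if a = 0 then liftVertex r + m else liftVertex a
        map_rel' := by
          intro a b hab
          by_cases ha : a = 0
          · subst ha
            obtain rfl := (hr b).1 hab
            simpa [hr0] using hdiam.symm
          · by_cases hb : b = 0
            · subst hb
              obtain rfl := (hr a).1 hab.symm
              simpa [hr0] using hdiam
            · simpa [ha, hb] using (foldTree_adj_of_ne ha hb).1 hab }
    have hlift {a b : ZMod (m + 1)} (ha : a ≠ 0) (hb : b ≠ 0)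
        (h : liftVertex a = liftVertex b) : a = b := by
      rw [← foldVertex_liftVertex ha, h, foldVertex_liftVertex hb]
    have hne (a b : ZMod (m + 1)) : liftVertex a + m ≠ liftVertex b := by
      intro h
      have := not_iff_val_add_half (liftVertex a)
      simp [h, val_liftVertex_lt] at this
    refine hG.1.isAcyclic.comap f fun a b hab => ?_
    change (if a = 0 then liftVertex r + m else liftVertex a) =
      (if b = 0 then liftVertex r + m else liftVertex b) at hab
    split_ifs at hab with ha hb hb
    · rw [ha, hb]
    · exact absurd hab (hne _ _)
    · exact absurd hab.symm (hne _ _)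
    · exact hlift ha hb hab
  · rintro a b c d hab hcd ⟨h1, h2, h3⟩
    have hne {u : ZMod (m + 1)} (hu : 0 < u.val) : u ≠ 0 := by
      rintro rfl
      rw [ZMod.val_zero] at hu
      exact lt_irrefl _ hu
    have hb := hne (u := b) (by omega)
    have hc := hne (u := c) (by omega)
    have hd := hne (u := d) (by omega)
    rw [foldTree_adj_of_ne hc hd] at hcd
    have vb := val_liftVertex b
    have vc := val_liftVertex c
    have vd := val_liftVertex d
    by_cases ha : a = 0
    · subst ha
      rw [foldTree_adj_zero hb] at hab
      have := hG.2 _ _ _ _ hcd hab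
      rw [val_add_half, if_pos (val_liftVertex_lt b)] at this
      have := val_liftVertex_lt d
      omega
    · rw [foldTree_adj_of_ne ha hb] at hab
      have va := val_liftVertex a
      have := val_pos_of_ne_zero ha
      have := hG.2 _ _ _ _ hab hcd
      omega

theorem halvedCount_eq : halvedCount m = A₁ (m + 1) := by
  rw [halvedCount, A₁]
  have hleaf (T : SimpleGraph (ZMod (m + 1))) :
      (T.neighborSet 0).ncard = 1 ↔ ∃ r, ∀ b, T.Adj 0 b ↔ b = r := by
    simp [Set.ncard_eq_one, Set.ext_iff]
  symm
  refine Nat.card_eq_of_bijective (fun T => ⟨unfoldTree T.1, ?_⟩) ⟨?_, ?_⟩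
  · obtain ⟨T, hT, h1⟩ := T
    obtain ⟨r, hr⟩ := (hleaf T).1 h1
    exact ⟨⟨isTree_unfoldTree hT.1 hr, noncrossing_unfoldTree hT.2 hr⟩, rotate_unfoldTree T,
      isHalved_unfoldTree T⟩
  · intro T U h
    exact Subtype.ext (unfoldTree_injective (congrArg Subtype.val h))
  · rintro ⟨G, hG, hfix, hhalf⟩
    obtain ⟨r, -, hr⟩ := exists_foldTree_adj_zero_iff hG hfix
    exact ⟨⟨foldTree G, isNCTree_foldTree hG hfix hhalf, (hleaf _).2 ⟨r, hr⟩⟩,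
      Subtype.ext (unfoldTree_foldTree hfix hhalf)⟩

end Half

/-! ### The orbit count -/

theorem fixedCount_eq_zero {n : ℕ} [NeZero n] {j : ZMod n} (hj : j ≠ 0) (h2 : j + j ≠ 0) :
    fixedCount n j = 0 := by
  rw [fixedCount, Nat.card_eq_zero]
  exact Or.inl ⟨fun G => h2 (exists_diameter G.2.1 hj G.2.2).1⟩

theorem Ar_formula :
    ∀ n : ℕ, 1 ≤ n →
      n * Ar n = A n + (if Even n then (n / 2) * A₁ (n / 2 + 1) else 0) := by
  intro n hn
  have : NeZero n := ⟨by omega⟩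
  rw [mul_Ar_eq_sum]
  split_ifs with he
  · obtain ⟨m, rfl⟩ := even_iff_two_dvd.1 he
    have : NeZero m := ⟨by omega⟩
    rw [Nat.mul_div_cancel_left m two_pos, ← halvedCount_eq, ← fixedCount_half,
      ← fixedCount_zero, Finset.sum_eq_add 0 (m : ZMod (2 * m)) half_ne_zero.symm]
    · rintro j - ⟨hj0, hjm⟩
      exact fixedCount_eq_zero hj0 fun h => hjm (eq_half_of_add_self hj0 h)
    · simp
    · simp
  · rw [add_zero, ← fixedCount_zero, Finset.sum_eq_single 0]
    · rintro j - hj0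
      exact fixedCount_eq_zero hj0 fun h => hj0 ((ZMod.add_self_eq_zero_iff_eq_zero
        (Nat.not_even_iff_odd.1 he)).1 h)
    · simp
end
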